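/- arXiv:2307.11057 — 2 statements merged into one kernel-verified Lean document; each statement's English description precedes it below -/
import Mathlib

section
/- Let (Q,ρ) be a directed set of states and < a total order on Q. There exists n ∈ ℕ such that for every transition f ⊆ Q×Q that is deterministic and planar with respect to ρ and <, the n-fold and (n+1)-fold gluing compositions of f with itself coincide: f^(n+1) = f^n. -/
namespace Planar2DFT

/-- Tape alphabet: input letters plus the two endmarkers `▷` and `◁`. -/
inductive Tape (A : Type) where
  | lend : Tape A
  | rend : Tape A
  | sym  : A → Tape A

/-- Edges of the transition profile `G(ρ, f)` on vertices `Q × Bool`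
(`true` codes direction `+1`, `false` codes `-1`): an edge
`(q, -ρ q) → (r, ρ r)` for every `(q, r) ∈ f`. -/
def ProfileEdge {Q : Type} (ρ : Q → Bool) (f : Set (Q × Q)) :
    Q × Bool → Q × Bool → Prop :=
  fun u v => ∃ p ∈ f, u = (p.1, !ρ p.1) ∧ v = (p.2, ρ p.2)

/-- The extension of a strict order on `Q` to `Q × Bool`:
`(q,i) < (r,j)` iff (`i = -1` and `j = 1`), or (`q < r` and `i = j = 1`),
or (`q > r` and `i = j = -1`). -/
def ExtLt {Q : Type} (lt : Q → Q → Prop) : Q × Bool → Q × Bool → Prop :=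
  fun x y =>
    (x.2 = false ∧ y.2 = true) ∨
    (lt x.1 y.1 ∧ x.2 = true ∧ y.2 = true) ∨
    (lt y.1 x.1 ∧ x.2 = false ∧ y.2 = false)

/-- Planarity of a transition w.r.t. a direction map `ρ` and a strict total
order `lt`: no vertices `u < r < v < s` with an edge between `u` and `v`
(in either direction) and an edge between `r` and `s` (in either direction). -/
def IsPlanar {Q : Type} (ρ : Q → Bool) (lt : Q → Q → Prop) (f : Set (Q × Q)) : Prop :=
  ¬ ∃ u r v s : Q × Bool, ExtLt lt u r ∧ ExtLt lt r v ∧ ExtLt lt v s ∧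
      (ProfileEdge ρ f u v ∨ ProfileEdge ρ f v u) ∧
      (ProfileEdge ρ f r s ∨ ProfileEdge ρ f s r)

/-- Deterministic transition: a partial function. -/
def IsDet {Q : Type} (f : Set (Q × Q)) : Prop :=
  ∀ q r r', (q, r) ∈ f → (q, r') ∈ f → r = r'

/-- Reversible transition: a partial injection. -/
def IsRev {Q : Type} (f : Set (Q × Q)) : Prop :=
  IsDet f ∧ ∀ q q' r, (q, r) ∈ f → (q', r) ∈ f → q = q'

/-- Edges of the glued graph `C(ρ, f, g)` on `Q × Fin 3`, levels `0, 1, 2`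
coding `-1, 0, 1`: the copy of `G(ρ,f)` lives on levels `{0,1}` (side `+1`
corresponding to level `1`) and the copy of `G(ρ,g)` on levels `{1,2}`
(side `+1` corresponding to level `2`). -/
def GlueEdge {Q : Type} (ρ : Q → Bool) (f g : Set (Q × Q)) :
    Q × Fin 3 → Q × Fin 3 → Prop :=
  fun x y =>
    (x.2 ≠ 2 ∧ y.2 ≠ 2 ∧
      ProfileEdge ρ f (x.1, decide (x.2 = 1)) (y.1, decide (y.2 = 1))) ∨
    (x.2 ≠ 0 ∧ y.2 ≠ 0 ∧
      ProfileEdge ρ g (x.1, decide (x.2 = 2)) (y.1, decide (y.2 = 2)))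

/-- Gluing composition `f * g` of transitions: `(q, r) ∈ f * g` iff there is a
directed path from `(q, -ρ q)` to `(r, ρ r)` in the glued graph `C(ρ, f, g)`. -/
def glue {Q : Type} (ρ : Q → Bool) (f g : Set (Q × Q)) : Set (Q × Q) :=
  {p | Relation.ReflTransGen (GlueEdge ρ f g)
        (p.1, if ρ p.1 then (0 : Fin 3) else 2)
        (p.2, if ρ p.2 then (2 : Fin 3) else 0)}

/-- The identity transition, unit of the gluing composition. -/
def idRel (Q : Type) : Set (Q × Q) := {p | p.1 = p.2}

/-- Iterated gluing powers of a transition, with `glpow ρ f 0 = idRel Q`. -/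
def glpow {Q : Type} (ρ : Q → Bool) (f : Set (Q × Q)) : ℕ → Set (Q × Q)
  | 0 => idRel Q
  | n + 1 => glue ρ (glpow ρ f n) f

/-- A configuration of a two-way machine: the tape content to the left of the
head, the current state, and the tape content to the right of the head. -/
abbrev Config (Q A : Type) := List (Tape A) × Q × List (Tape A)

/-- The tape encoding `▷ u ◁` of an input word `u`. -/
def tapeOf {A : Type} (u : List A) : List (Tape A) :=
  Tape.lend :: (u.map Tape.sym ++ [Tape.rend])

/-- A two-way (nondeterministic) finite transducer. -/
structure TwoWayTransducer (Q A B : Type) where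
  ρ : Q → Bool
  init : Q
  init_fwd : ρ init = true
  final : Set Q
  δ : Tape A → Set (Q × List B × Q)

namespace TwoWayTransducer

variable {Q A B : Type}

/-- The transitions `⌊δ⌋(a)` of the underlying automaton. -/
def rel (T : TwoWayTransducer Q A B) (a : Tape A) : Set (Q × Q) :=
  {p | ∃ w, (p.1, w, p.2) ∈ T.δ a}

def Deterministic (T : TwoWayTransducer Q A B) : Prop :=
  ∀ a, IsDet (T.rel a)

def Reversible (T : TwoWayTransducer Q A B) : Prop :=
  ∀ a, IsRev (T.rel a)

def Planar (T : TwoWayTransducer Q A B) : Prop :=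
  ∃ lt : Q → Q → Prop, IsStrictTotalOrder Q lt ∧
    ∀ a : A, IsPlanar T.ρ lt (T.rel (Tape.sym a))

/-- One step of the two-way transducer, labelled by the output word. -/
def Step (T : TwoWayTransducer Q A B) (c : Config Q A) (w : List B)
    (c' : Config Q A) : Prop :=
  ∃ a u v q r, (q, w, r) ∈ T.δ a ∧
    ((T.ρ q = true ∧ T.ρ r = true ∧ c = (u, q, a :: v) ∧ c' = (u ++ [a], r, v)) ∨
     (T.ρ q = true ∧ T.ρ r = false ∧ c = (u, q, a :: v) ∧ c' = (u, r, a :: v)) ∨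
     (T.ρ q = false ∧ T.ρ r = false ∧ c = (u ++ [a], q, v) ∧ c' = (u, r, a :: v)) ∨
     (T.ρ q = false ∧ T.ρ r = true ∧ c = (u ++ [a], q, v) ∧ c' = (u ++ [a], r, v)))

/-- Multi-step runs, accumulating the concatenated output. -/
inductive Run (T : TwoWayTransducer Q A B) : Config Q A → List B → Config Q A → Prop
  | refl (c : Config Q A) : Run T c [] c
  | step {c₁ w₁ c₂ w₂ c₃} : Run T c₁ w₁ c₂ → T.Step c₂ w₂ c₃ → Run T c₁ (w₁ ++ w₂) c₃

/-- The pair `(u, v)` is realized by `T`. -/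
def Realizes (T : TwoWayTransducer Q A B) (u : List A) (v : List B) : Prop :=
  ∃ qf ∈ T.final, T.Run ([], T.init, tapeOf u) v (tapeOf u, qf, [])

/-- `T` computes the partial function `f`. -/
def Computes (T : TwoWayTransducer Q A B) (f : List A → Option (List B)) : Prop :=
  ∀ u v, f u = some v ↔ T.Realizes u v

end TwoWayTransducer

/-- Membership in the least submonoid of `B(Q,ρ)` containing the transitions
`⌊δ⌋(a)` for the input letters `a`. -/
inductive InBehav {Q A B : Type} (T : TwoWayTransducer Q A B) : Set (Q × Q) → Prop
  | one : InBehav T (idRel Q)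
  | gen (a : A) : InBehav T (T.rel (Tape.sym a))
  | mul {f g} : InBehav T f → InBehav T g → InBehav T (glue T.ρ f g)

/-- The behaviour monoid `B(T)` is aperiodic. -/
def ApBehav {Q A B : Type} (T : TwoWayTransducer Q A B) : Prop :=
  ∃ n : ℕ, ∀ f, InBehav T f → glpow T.ρ f (n + 1) = glpow T.ρ f n

/-- A first-order transduction: a partial function computed by some
deterministic two-way transducer whose behaviour monoid is aperiodic. -/
def IsFOTransduction {A B : Type} (f : List A → Option (List B)) : Prop :=
  ∃ (n : ℕ) (T : TwoWayTransducer (Fin n) A B),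
    T.Deterministic ∧ ApBehav T ∧ T.Computes f

/-- A two-way (nondeterministic) finite automaton. -/
structure TwoWayAutomaton (Q A : Type) where
  ρ : Q → Bool
  init : Q
  init_fwd : ρ init = true
  final : Set Q
  δ : Tape A → Set (Q × Q)

namespace TwoWayAutomaton

variable {Q A : Type}

def Deterministic (M : TwoWayAutomaton Q A) : Prop := ∀ a, IsDet (M.δ a)

def Reversible (M : TwoWayAutomaton Q A) : Prop := ∀ a, IsRev (M.δ a)

def Planar (M : TwoWayAutomaton Q A) : Prop :=
  ∃ lt : Q → Q → Prop, IsStrictTotalOrder Q lt ∧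
    ∀ a : A, IsPlanar M.ρ lt (M.δ (Tape.sym a))

/-- One step of the two-way automaton. -/
def Step (M : TwoWayAutomaton Q A) (c c' : Config Q A) : Prop :=
  ∃ a u v q r, (q, r) ∈ M.δ a ∧
    ((M.ρ q = true ∧ M.ρ r = true ∧ c = (u, q, a :: v) ∧ c' = (u ++ [a], r, v)) ∨
     (M.ρ q = true ∧ M.ρ r = false ∧ c = (u, q, a :: v) ∧ c' = (u, r, a :: v)) ∨
     (M.ρ q = false ∧ M.ρ r = false ∧ c = (u ++ [a], q, v) ∧ c' = (u, r, a :: v)) ∨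
     (M.ρ q = false ∧ M.ρ r = true ∧ c = (u ++ [a], q, v) ∧ c' = (u ++ [a], r, v)))

def Accepts (M : TwoWayAutomaton Q A) (u : List A) : Prop :=
  ∃ qf ∈ M.final, Relation.ReflTransGen M.Step
    ([], M.init, tapeOf u) (tapeOf u, qf, [])

def Language (M : TwoWayAutomaton Q A) : Set (List A) := {u | M.Accepts u}

end TwoWayAutomaton

/-- The underlying automaton `⌊T⌋` of a transducer `T`. -/
def forget {Q A B : Type} (T : TwoWayTransducer Q A B) : TwoWayAutomaton Q A :=
  { ρ := T.ρ, init := T.init, init_fwd := T.init_fwd, final := T.final,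
    δ := fun a => T.rel a }

/-- Star-free languages: the smallest class containing all finite languages
and closed under finite union, complement and concatenation. -/
inductive StarFree {A : Type} : Set (List A) → Prop
  | of_finite (L : Set (List A)) : L.Finite → StarFree L
  | union {L M : Set (List A)} : StarFree L → StarFree M → StarFree (L ∪ M)
  | compl {L : Set (List A)} : StarFree L → StarFree Lᶜ
  | concat {L M : Set (List A)} : StarFree L → StarFree M →
      StarFree {w | ∃ u ∈ L, ∃ v ∈ M, w = u ++ v}

/-- A (total, deterministic) sequential transducer. -/
structure SeqTransducer (Q A B : Type) where
  init : Q
  next : A → Q → Q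
  out : A → Q → List B
  fin : Q → List B

namespace SeqTransducer

variable {Q A B : Type}

/-- Running a sequential transducer on a word from a state: final state and
produced output. -/
def run (T : SeqTransducer Q A B) : List A → Q → Q × List B
  | [], q => (q, [])
  | a :: w, q =>
      let p := run T w (T.next a q)
      (p.1, T.out a q ++ p.2)

/-- The (total) sequential function computed by a sequential transducer. -/
def fn (T : SeqTransducer Q A B) (w : List A) : List B :=
  (T.run w T.init).2 ++ T.fin (T.run w T.init).1

end SeqTransducer

/-- Membership in the transition monoid of a sequential transducer, i.e. the
monoid of functions `Q → Q` generated by the `∂₁(a)`. -/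
inductive SeqGen {Q A B : Type} (T : SeqTransducer Q A B) : (Q → Q) → Prop
  | id : SeqGen T id
  | gen (a : A) : SeqGen T (T.next a)
  | comp {h h'} : SeqGen T h → SeqGen T h' → SeqGen T (h ∘ h')

/-- A sequential transducer is aperiodic when its transition monoid is. -/
def SeqTransducer.Aperiodic {Q A B : Type} (T : SeqTransducer Q A B) : Prop :=
  ∃ n : ℕ, ∀ h, SeqGen T h → h^[n + 1] = h^[n]



lemma rtg_lift {α β : Type} {R : α → α → Prop} {S : β → β → Prop} (g : α → β)
    (hg : ∀ a b, R a b → Relation.ReflTransGen S (g a) (g b)) {x y : α}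
    (h : Relation.ReflTransGen R x y) : Relation.ReflTransGen S (g x) (g y) := by
  induction h with
  | refl => exact .refl
  | tail _ h ih => exact ih.trans (hg _ _ h)

section Strip

variable {Q : Type} (ρ : Q → Bool) (f : Set (Q × Q))

/-- `v` is a source vertex for the cell `c` (between levels `c` and `c+1`). -/
def OutAt (v : Q × ℕ) (c : ℕ) : Prop := v.2 = if ρ v.1 then c else c + 1

/-- `v` is a target vertex for the cell `c`. -/
def InAt (v : Q × ℕ) (c : ℕ) : Prop := v.2 = if ρ v.1 then c + 1 else c

/-- Edges of the strip made of copies of `f` in the cells `i ≤ c < j`. -/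
def SE (i j : ℕ) (v w : Q × ℕ) : Prop :=
  ∃ c, i ≤ c ∧ c < j ∧ (v.1, w.1) ∈ f ∧ OutAt ρ v c ∧ InAt ρ w c

/-- Paths in the strip. -/
abbrev SP (i j : ℕ) : Q × ℕ → Q × ℕ → Prop := Relation.ReflTransGen (SE ρ f i j)

variable {ρ f}

lemma SE.mono {i j i' j' : ℕ} (hi : i' ≤ i) (hj : j ≤ j') {v w : Q × ℕ} (h : SE ρ f i j v w) :
    SE ρ f i' j' v w := by
  obtain ⟨c, h1, h2, h3⟩ := h
  exact ⟨c, by omega, by omega, h3⟩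

lemma SP.mono {i j i' j' : ℕ} (hi : i' ≤ i) (hj : j ≤ j') {v w : Q × ℕ} (h : SP ρ f i j v w) :
    SP ρ f i' j' v w :=
  rtg_lift id (fun _ _ h => .single (h.mono hi hj)) h

lemma SP.shift {i j k : ℕ} {v w : Q × ℕ} (h : SP ρ f i j v w) :
    SP ρ f (i + k) (j + k) (v.1, v.2 + k) (w.1, w.2 + k) := by
  refine rtg_lift (fun v : Q × ℕ => (v.1, v.2 + k)) ?_ h
  rintro a b ⟨c, h1, h2, h3, h4, h5⟩
  refine .single ⟨c + k, by omega, by omega, h3, ?_, ?_⟩ <;> simp only [OutAt, InAt] at * <;>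
    split_ifs at * <;> omega

lemma SP.unshift {i j k : ℕ} {v w : Q × ℕ} (h : SP ρ f (i + k) (j + k) v w) :
    SP ρ f i j (v.1, v.2 - k) (w.1, w.2 - k) := by
  refine rtg_lift (fun v : Q × ℕ => (v.1, v.2 - k)) ?_ h
  rintro a b ⟨c, h1, h2, h3, h4, h5⟩
  refine .single ⟨c - k, by omega, by omega, h3, ?_, ?_⟩ <;> simp only [OutAt, InAt] at * <;>
    split_ifs at * <;> omega

/-- the end vertex at the exit of the strip `[0,n]` is a sink -/
lemma sink {n : ℕ} {r : Q} {w : Q × ℕ} : ¬ SE ρ f 0 n (r, if ρ r then n else 0) w := by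
  rintro ⟨c, h1, h2, h3, h4, h5⟩
  simp only [OutAt] at h4
  split_ifs at h4 <;> omega

lemma SE.det (hd : IsDet f) {n : ℕ} {v w w' : Q × ℕ} (h : SE ρ f 0 n v w) (h' : SE ρ f 0 n v w') :
    w = w' := by
  obtain ⟨c, h1, h2, h3, h4, h5⟩ := h
  obtain ⟨c', h1', h2', h3', h4', h5'⟩ := h'
  have e := hd _ _ _ h3 h3'
  simp only [OutAt, InAt] at *
  rw [← e] at h5'
  refine Prod.ext e ?_
  split_ifs at * <;> omega

lemma SP.of_sink {R : Q × ℕ → Q × ℕ → Prop} {z w : Q × ℕ} (hz : ∀ w, ¬ R z w)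
    (h : Relation.ReflTransGen R z w) : z = w := by
  rcases Relation.ReflTransGen.cases_head h with h | ⟨c, h, _⟩
  · exact h
  · exact absurd h (hz _)

lemma SP.end_unique (hd : IsDet f) {n : ℕ} {v : Q × ℕ} {r r' : Q}
    (h : SP ρ f 0 n v (r, if ρ r then n else 0)) (h' : SP ρ f 0 n v (r', if ρ r' then n else 0)) :
    r = r' := by
  rcases Relation.ReflTransGen.total_of_right_unique
      (r := SE ρ f 0 n) (fun _ _ _ => SE.det hd) h h' with h | h
  · exact congrArg Prod.fst (SP.of_sink (fun _ => sink) h)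
  · exact (congrArg Prod.fst (SP.of_sink (fun _ => sink) h)).symm

/-- gluing powers are strips -/
lemma mem_glpow_iff (n : ℕ) : ∀ q r : Q, (q, r) ∈ glpow ρ f n ↔
    SP ρ f 0 n (q, if ρ q then 0 else n) (r, if ρ r then n else 0) := by
  induction n with
  | zero =>
    intro q r
    simp only [glpow, idRel, Set.mem_ofPred_eq, ite_self]
    constructor
    · rintro rfl; exact .refl
    · intro h
      refine congrArg Prod.fst (SP.of_sink ?_ h)
      rintro w ⟨c, _, h, _⟩; omega
  | succ n ih =>
    intro q r
    constructor
    · intro h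
      simp only [glpow, glue, Set.mem_ofPred_eq] at h
      have := rtg_lift (R := GlueEdge ρ (glpow ρ f n) f) (S := SE ρ f 0 (n+1))
        (fun x : Q × Fin 3 => (x.1, if x.2 = 0 then 0 else if x.2 = 1 then n else n + 1)) ?_ h
      · convert this using 2 <;> split_ifs <;> simp_all
      · rintro ⟨a, i⟩ ⟨b, j⟩ h
        rcases h with ⟨hi, hj, ⟨x, y⟩, hp, h1, h2⟩ | ⟨hi, hj, ⟨x, y⟩, hp, h1, h2⟩
        · simp only [Prod.mk.injEq] at h1 h2
          obtain ⟨rfl, h1⟩ := h1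
          obtain ⟨rfl, h2⟩ := h2
          have := SP.mono (le_refl 0) (Nat.le_succ n) ((ih _ _).1 hp)
          convert this using 2
          · fin_cases i <;> cases h : ρ a <;> simp_all
          · fin_cases j <;> cases h : ρ b <;> simp_all
        · simp only [Prod.mk.injEq] at h1 h2
          obtain ⟨rfl, h1⟩ := h1
          obtain ⟨rfl, h2⟩ := h2
          refine .single ⟨n, by omega, by omega, hp, ?_, ?_⟩
          · fin_cases i <;> cases h : ρ a <;> simp_all [OutAt]
          · fin_cases j <;> cases h : ρ b <;> simp_all [InAt]
    · intro h
      simp only [glpow, glue, Set.mem_ofPred_eq]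
      have leftEdge : ∀ s r' : Q, (s, r') ∈ glpow ρ f n →
          GlueEdge ρ (glpow ρ f n) f (s, if ρ s then 0 else 1) (r', if ρ r' then 1 else 0) := by
        intro s r' hs
        refine Or.inl ⟨by split_ifs <;> simp, by split_ifs <;> simp, (s, r'), hs, ?_, ?_⟩
        · cases h : ρ s <;> simp
        · cases h : ρ r' <;> simp
      have rightEdge : ∀ s r' : Q, (s, r') ∈ f →
          GlueEdge ρ (glpow ρ f n) f (s, if ρ s then 1 else 2) (r', if ρ r' then 2 else 1) := by
        intro s r' hs
        refine Or.inr ⟨by split_ifs <;> simp, by split_ifs <;> simp, (s, r'), hs, ?_, ?_⟩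
        · cases h : ρ s <;> simp
        · cases h : ρ r' <;> simp
      have key : ∀ v : Q × ℕ, SP ρ f 0 (n+1) v (r, if ρ r then n + 1 else 0) →
          (((v.2 = n ∧ ρ v.1 = true) ∨ v.2 = n + 1) ∧
            Relation.ReflTransGen (GlueEdge ρ (glpow ρ f n) f)
              (v.1, if v.2 = n then 1 else 2) (r, if ρ r then 2 else 0)) ∨
          (∃ r', SP ρ f 0 n v (r', if ρ r' then n else 0) ∧
            Relation.ReflTransGen (GlueEdge ρ (glpow ρ f n) f)
              (r', if ρ r' then 1 else 0) (r, if ρ r then 2 else 0)) := by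
        intro v hv
        induction hv using Relation.ReflTransGen.head_induction_on with
        | refl =>
          cases hr : ρ r
          · right
            refine ⟨r, ?_, ?_⟩ <;> simp [hr] <;> exact .refl
          · left
            simp; exact .refl
        | head hvw hwz IH =>
          rename_i v w
          obtain ⟨v, l⟩ := v
          obtain ⟨w, k⟩ := w
          obtain ⟨c, h1, h2, h3, h4, h5⟩ := hvw
          simp only [OutAt, InAt] at *
          by_cases hc : c = n
          · subst hc
            have hE := rightEdge v w h3
            have hl : (v, if l = c then (1 : Fin 3) else 2) = (v, if ρ v then 1 else 2) := by
              cases h : ρ v <;> simp_all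
            left
            refine ⟨by cases h : ρ v <;> simp_all, ?_⟩
            rw [hl]
            refine .head hE ?_
            rcases IH with ⟨ha, hb⟩ | ⟨r', ha, hb⟩
            · cases h : ρ w <;> simp_all
            · cases h : ρ w
              · simp only [h, Bool.false_eq_true, if_false] at h5 ha ⊢
                refine .head (b := (r', if ρ r' then 1 else 0)) ?_ hb
                have := leftEdge w r' ((ih _ _).2 (by simpa [h, h5] using ha))
                simpa [h] using this
              · exfalso
                simp only [h, if_true] at h5
                subst h5
                rcases Relation.ReflTransGen.cases_head ha with e | ⟨_, ⟨c', e1, e2, e3, e4, e5⟩, _⟩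
                · have := congrArg Prod.snd e
                  simp only at this
                  split_ifs at this <;> omega
                · simp only [OutAt, h, if_true] at e4
                  omega
          · right
            have hc' : c < n := by omega
            rcases IH with ⟨ha, hb⟩ | ⟨r', ha, hb⟩
            · have hw : ρ w = true ∧ k = n := by
                cases h : ρ w <;> simp_all <;> omega
              obtain ⟨hw, rfl⟩ := hw
              refine ⟨w, .single ⟨c, h1, hc', h3, h4, ?_⟩, ?_⟩
              · simpa [InAt, hw] using h5
              · simpa [hw] using hb
            · exact ⟨r', .head (show SE ρ f 0 n (v, l) (w, k) from ⟨c, h1, hc', h3, h4, h5⟩) ha, hb⟩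
      have k0 := key _ h
      cases hq : ρ q
      · simp only [hq, Bool.false_eq_true, if_false] at k0 ⊢
        rcases k0 with ⟨_, hb⟩ | ⟨r', ha, hb⟩
        · simpa using hb
        · exfalso
          rcases Relation.ReflTransGen.cases_head ha with e | ⟨_, ⟨c', e1, e2, e3, e4, e5⟩, _⟩
          · have := congrArg Prod.snd e
            simp only at this
            split_ifs at this <;> omega
          · simp only [OutAt, hq, Bool.false_eq_true, if_false] at e4
            omega
      · simp only [hq, if_true] at k0 ⊢
        rcases k0 with ⟨ha, hb⟩ | ⟨r', ha, hb⟩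
        · have hn : n = 0 := by simpa [hq, eq_comm] using ha
          subst hn
          refine .head ?_ hb
          have := leftEdge q q rfl
          simpa [hq] using this
        · refine .head ?_ hb
          have := leftEdge q r' ((ih _ _).2 (by simpa [hq] using ha))
          simpa [hq] using this

/-- mirror image -/
lemma SP.mirror {n : ℕ} {v w : Q × ℕ} (h : SP ρ f 0 n v w) :
    SP (fun q => !ρ q) f 0 n (v.1, n - v.2) (w.1, n - w.2) := by
  refine rtg_lift (fun v : Q × ℕ => (v.1, n - v.2)) ?_ h
  rintro a b ⟨c, h1, h2, h3, h4, h5⟩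
  refine .single ⟨n - 1 - c, by omega, by omega, h3, ?_, ?_⟩ <;> simp only [OutAt, InAt] at *
  · rcases Bool.eq_false_or_eq_true (ρ a.1) with h | h <;> simp [h] at h4 ⊢ <;> omega
  · rcases Bool.eq_false_or_eq_true (ρ b.1) with h | h <;> simp [h] at h5 ⊢ <;> omega

lemma glpow_mirror_sub {n : ℕ} {q r : Q} (h : (q, r) ∈ glpow ρ f n) :
    (q, r) ∈ glpow (fun q => !ρ q) f n := by
  rw [mem_glpow_iff] at *
  convert SP.mirror h using 2
  · cases ρ q <;> simp
  · cases ρ r <;> simp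

lemma glpow_mirror {n : ℕ} {q r : Q} :
    (q, r) ∈ glpow (fun q => !ρ q) f n ↔ (q, r) ∈ glpow ρ f n := by
  refine ⟨fun h => ?_, glpow_mirror_sub⟩
  have := glpow_mirror_sub h
  simpa using this

lemma planar_mirror {lt : Q → Q → Prop} (h : IsPlanar ρ lt f) :
    IsPlanar (fun q => !ρ q) lt f := by
  rintro ⟨u, r, v, s, h1, h2, h3, h4, h5⟩
  have hlt : ∀ x y : Q × Bool, ExtLt lt x y → ExtLt lt (y.1, !y.2) (x.1, !x.2) := by
    rintro ⟨x, i⟩ ⟨y, j⟩ hxy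
    cases i <;> cases j <;> simp_all [ExtLt]
  have hE : ∀ x y : Q × Bool, ProfileEdge (fun q => !ρ q) f x y →
      ProfileEdge ρ f (x.1, !x.2) (y.1, !y.2) := by
    rintro x y ⟨p, hp, rfl, rfl⟩
    exact ⟨p, hp, by simp, by simp⟩
  exact h ⟨_, _, _, _, hlt _ _ h3, hlt _ _ h2, hlt _ _ h1,
    (h5.imp (hE _ _) (hE _ _)).symm, (h4.imp (hE _ _) (hE _ _)).symm⟩

end Strip

section Order

variable {Q : Type} [LinearOrder Q] {ρ : Q → Bool} {f : Set (Q × Q)}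

/-- same level and smaller -/
def dl (v b : Q × ℕ) : ZMod 2 := if v.2 = b.2 ∧ v.1 < b.1 then 1 else 0

lemma cross_zero (hp : IsPlanar ρ (· < ·) f) {c : ℕ} {v w b b' : Q × ℕ}
    (h1 : (v.1, w.1) ∈ f) (h2 : OutAt ρ v c) (h3 : InAt ρ w c)
    (h1' : (b.1, b'.1) ∈ f) (h2' : OutAt ρ b c) (h3' : InAt ρ b' c)
    (n1 : v ≠ b) (n2 : v ≠ b') (n3 : w ≠ b) (n4 : w ≠ b') :
    dl v b + dl v b' + (dl w b + dl w b') = 0 := by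
  obtain ⟨v, l⟩ := v
  obtain ⟨w, k⟩ := w
  obtain ⟨b, i⟩ := b
  obtain ⟨b', j⟩ := b'
  change l = if ρ v then c else c + 1 at h2
  change k = if ρ w then c + 1 else c at h3
  change i = if ρ b then c else c + 1 at h2'
  change j = if ρ b' then c + 1 else c at h3'
  change (v, w) ∈ f at h1
  change (b, b') ∈ f at h1'
  subst h2 h3 h2' h3'
  have E : ∀ x y, (x, y) ∈ f → ProfileEdge ρ f (x, !ρ x) (y, ρ y) := fun x y h => ⟨_, h, rfl, rfl⟩
  have e := E _ _ h1
  have e' := E _ _ h1'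
  have P : ∀ u r v s : Q × Bool,
    (ProfileEdge ρ f u v ∨ ProfileEdge ρ f v u) → (ProfileEdge ρ f r s ∨ ProfileEdge ρ f s r) →
     ¬ (ExtLt (· < ·) u r ∧ ExtLt (· < ·) r v ∧ ExtLt (· < ·) v s) := by
    intro u r v s a b hh
    exact hp ⟨u, r, v, s, hh.1, hh.2.1, hh.2.2, a, b⟩
  have p1 := P _ _ _ _ (Or.inl e) (Or.inl e')
  have p2 := P _ _ _ _ (Or.inl e) (Or.inr e')
  have p3 := P _ _ _ _ (Or.inr e) (Or.inl e')
  have p4 := P _ _ _ _ (Or.inr e) (Or.inr e')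
  have p5 := P _ _ _ _ (Or.inl e') (Or.inl e)
  have p6 := P _ _ _ _ (Or.inl e') (Or.inr e)
  have p7 := P _ _ _ _ (Or.inr e') (Or.inl e)
  have p8 := P _ _ _ _ (Or.inr e') (Or.inr e)
  have two : (1 : ZMod 2) + 1 = 0 := by decide
  clear hp P E e e' h1 h1'
  simp only [dl]
  cases hv : ρ v <;> cases hw : ρ w <;> cases hb : ρ b <;> cases hb' : ρ b' <;>
    simp [ExtLt, hv, hw, hb, hb'] at * <;>
    first
    | grind
    | (rcases lt_or_gt_of_ne n1 with a1 | a1 <;> rcases lt_or_gt_of_ne n2 with a2 | a2 <;>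
        rcases lt_or_gt_of_ne n3 with a3 | a3 <;> rcases lt_or_gt_of_ne n4 with a4 | a4 <;>
        simp only [a1, a2, a3, a4, not_lt_of_gt, not_le_of_gt, if_true, if_false, true_imp_iff]
          at p1 p2 p3 p4 p5 p6 p7 p8 ⊢ <;>
        first
        | decide
        | order)

/-- winding numbers of the path ending at `(r,n)` -/
lemma winding (hp : IsPlanar ρ (· < ·) f) {n : ℕ} (hn : 0 < n) {r : Q} (hr : ρ r = true)
    (v : Q × ℕ) (h : SP ρ f 0 n v (r, n)) :
    ∃ V : Q × ℕ → ZMod 2,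
      (∀ c b b', c < n → (b.1, b'.1) ∈ f → OutAt ρ b c → InAt ρ b' c →
        ¬ SP ρ f 0 n b (r, n) → ¬ SP ρ f 0 n b' (r, n) →
        (InAt ρ v c → V b + V b' = dl v b + dl v b') ∧ (¬ InAt ρ v c → V b + V b' = 0)) ∧
      (¬ (ρ v.1 = false ∧ v.2 = n) → ∀ s, V (s, n) = dl (r, n) (s, n)) ∧
      (∀ s, V (s, 0) = dl v (s, 0)) := by
  induction h using Relation.ReflTransGen.head_induction_on with
  | refl =>
    refine ⟨dl (r, n), ?_, fun _ _ => rfl, fun _ => rfl⟩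
    intro c b b' hc hf hb hb' _ _
    refine ⟨fun _ => rfl, fun hin => ?_⟩
    simp only [InAt, OutAt, hr, if_true] at *
    have a1 : ¬ n = b.2 := by split_ifs at hb <;> omega
    have a2 : ¬ n = b'.2 := by split_ifs at hb' <;> omega
    simp [dl, a1, a2]
  | head hvw hwz IH =>
    rename_i v w
    obtain ⟨V, i1, i2, i3⟩ := IH
    have hvw0 := hvw
    obtain ⟨c, g1, g2, g3, g4, g5⟩ := hvw
    refine ⟨fun b => dl v b + V b, ?_, ?_, ?_⟩
    · intro c' b b' hc hf hb hb' nb nb'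
      have hX := i1 c' b b' hc hf hb hb' nb nb'
      have re : dl v b + V b + (dl v b' + V b') = dl v b + dl v b' + (V b + V b') := by ring
      simp only [re]
      have hvz : SP ρ f 0 n v (r, n) := .head hvw0 hwz
      by_cases hcc : c' = c
      · subst hcc
        have hnot : ¬ InAt ρ v c' := by
          simp only [InAt, OutAt] at *
          split_ifs at * <;> omega
        refine ⟨fun hh => absurd hh hnot, fun _ => ?_⟩
        rw [hX.1 g5]
        refine cross_zero hp g3 g4 g5 hf hb hb' ?_ ?_ ?_ ?_ <;> rintro rfl <;> contradiction
      · have hnw : ¬ InAt ρ w c' := by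
          simp only [InAt, OutAt] at *
          split_ifs at * <;> omega
        rw [hX.2 hnw, add_zero]
        refine ⟨fun _ => rfl, fun hnv => ?_⟩
        have a1 : ¬ v.2 = b.2 := by
          simp only [InAt, OutAt] at *
          split_ifs at * <;> omega
        have a2 : ¬ v.2 = b'.2 := by
          simp only [InAt, OutAt] at *
          split_ifs at * <;> omega
        simp [dl, a1, a2]
    · intro hv s
      have hw : ¬ (ρ w.1 = false ∧ w.2 = n) := by
        rintro ⟨e1, e2⟩
        simp only [InAt, e1] at g5
        simp at g5
        omega
      have a1 : ¬ v.2 = n := by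
        intro e
        apply hv
        refine ⟨?_, e⟩
        cases e1 : ρ v.1
        · rfl
        · simp only [OutAt, e1] at g4
          simp at g4
          omega
      simp only [i2 hw s]
      simp [dl, a1]
    · intro s
      have a1 : ¬ w.2 = 0 := by
        intro e
        have e1 : ρ w.1 = false := by
          cases e1 : ρ w.1
          · rfl
          · simp only [InAt, e1, if_true] at g5
            omega
        have : w = (w.1, if ρ w.1 then n else 0) := by
          rw [e1]; exact Prod.ext rfl e
        rw [this] at hwz
        have := congrArg Prod.snd (SP.of_sink (fun _ => sink) hwz)
        simp [e1] at this
        omega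
      simp only [i3 s]
      simp [dl, a1]

/-- left-to-right crossings are monotone -/
lemma lr_mono (hd : IsDet f) (hp : IsPlanar ρ (· < ·) f) {n : ℕ} (hn : 0 < n) {q q' r r' : Q}
    (hr : ρ r = true) (hr' : ρ r' = true)
    (h : SP ρ f 0 n (q, 0) (r, n)) (h' : SP ρ f 0 n (q', 0) (r', n)) (hq : q ≤ q') : r ≤ r' := by
  by_cases hrr : r = r'
  · exact hrr.le
  have uniq : ∀ v, SP ρ f 0 n v (r, n) → SP ρ f 0 n v (r', n) → False := by
    intro v a b
    exact hrr (SP.end_unique hd (v := v) (n := n) (ρ := ρ) (by simpa [hr] using a)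
      (by simpa [hr'] using b))
  have hqq : q < q' := lt_of_le_of_ne hq (by rintro rfl; exact uniq _ h h')
  obtain ⟨V, i1, i2, i3⟩ := winding hp hn hr _ h
  have inv : ∀ v, SP ρ f 0 n v (r', n) → V v = V (r', n) := by
    intro v hv
    induction hv using Relation.ReflTransGen.head_induction_on with
    | refl => rfl
    | head hvw hwz IH =>
      rename_i v w
      rw [← IH]
      have hvw0 := hvw
      obtain ⟨c, g1, g2, g3, g4, g5⟩ := hvw
      have := (i1 c v w g2 g3 g4 g5 (fun a => uniq _ a (.head hvw0 hwz))
        (fun a => uniq _ a hwz)).2 ?_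
      · have t : ∀ x y : ZMod 2, x + y = 0 → x = y := by decide
        exact t _ _ this
      · change ¬ (0 = if ρ q then c + 1 else c)
        have : ∃ s, SE ρ f 0 n (q, 0) s := by
          rcases Relation.ReflTransGen.cases_head h with e | ⟨s, e, _⟩
          · have := congrArg Prod.snd e
            simp only at this
            omega
          · exact ⟨s, e⟩
        obtain ⟨s, c', k1, k2, k3, k4, k5⟩ := this
        change 0 = if ρ q then c' else c' + 1 at k4
        rcases Bool.eq_false_or_eq_true (ρ q) with h | h <;> simp [h] at k4 ⊢
  have e := inv _ h'
  rw [i3, i2 (by simp only [not_and]; intro _; omega)] at e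
  by_contra hlt
  rw [dl, dl, if_pos (by simpa using hqq), if_neg (by simp; exact (not_le.1 hlt).le)] at e
  exact absurd e (by decide)

/-- domains decrease -/
lemma dom_anti {n : ℕ} {v : Q × ℕ} {r : Q} (hr : ρ r = true) (h : SP ρ f 0 (n+1) v (r, n+1))
    (hv : v.2 < n ∨ (v.2 = n ∧ ρ v.1 = false)) :
    ∃ r', ρ r' = true ∧ SP ρ f 0 n v (r', n) := by
  induction h using Relation.ReflTransGen.head_induction_on with
  | refl => simp at hv
  | head hvw hwz IH =>
    rename_i v w
    obtain ⟨c, g1, g2, g3, g4, g5⟩ := hvw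
    have hc : c < n := by
      simp only [OutAt] at g4
      cases e : ρ v.1 <;> simp [e] at * <;> omega
    have hE : SE ρ f 0 n v w := ⟨c, g1, hc, g3, g4, g5⟩
    by_cases hw : w.2 < n ∨ (w.2 = n ∧ ρ w.1 = false)
    · obtain ⟨r', a, b⟩ := IH hw
      exact ⟨r', a, .head hE b⟩
    · simp only [InAt] at g5
      cases e : ρ w.1
      · simp [e] at *; omega
      · have : w = (w.1, n) := by
          refine Prod.ext rfl ?_
          simp [e] at *; omega
        exact ⟨w.1, e, by rw [← this]; exact .single hE⟩

lemma dom_anti' {q : Q} {n m : ℕ} (hn : n ≤ m) (hq : ρ q = true)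
    (h : ∃ r, ρ r = true ∧ SP ρ f 0 m (q, 0) (r, m)) :
    ∃ r, ρ r = true ∧ SP ρ f 0 n (q, 0) (r, n) := by
  induction m, hn using Nat.le_induction with
  | base => exact h
  | succ m hm ih =>
    obtain ⟨r, hr, h⟩ := h
    by_cases h0 : m = 0
    · have : n = 0 := by omega
      subst this
      exact ⟨q, hq, .refl⟩
    · exact ih (dom_anti hr h (Or.inl (by simp only; omega)))

/-- last crossing -/
lemma last_cross {t N : ℕ} (htN : t < N) {r : Q} {v : Q × ℕ} (h : SP ρ f 0 N v (r, N)) :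
    SP ρ f t N v (r, N) ∨ ∃ d, ρ d = true ∧ SP ρ f 0 N v (d, t) ∧ SP ρ f t N (d, t) (r, N) := by
  induction h using Relation.ReflTransGen.head_induction_on with
  | refl => exact Or.inl .refl
  | head hvw hwz IH =>
    rename_i v w
    have hvw0 := hvw
    obtain ⟨c, g1, g2, g3, g4, g5⟩ := hvw
    rcases IH with IH | ⟨d, a, b, e⟩
    · by_cases hc : t ≤ c
      · exact Or.inl (.head ⟨c, hc, g2, g3, g4, g5⟩ IH)
      · right
        have : ρ w.1 = true ∧ w.2 = t := by
          simp only [InAt] at g5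
          rcases Relation.ReflTransGen.cases_head IH with rfl | ⟨s, ⟨c', k1, k2, k3, k4, k5⟩, _⟩
          · simp only at g5
            split_ifs at g5 <;> omega
          · simp only [OutAt] at k4
            cases e : ρ w.1
            · simp [e] at *; omega
            · simp [e] at *; omega
        have hw : w = (w.1, t) := Prod.ext rfl this.2
        refine ⟨w.1, this.1, ?_, ?_⟩
        · rw [← hw]; exact .single hvw0
        · rw [← hw]; exact IH
    · exact Or.inr ⟨d, a, .head hvw0 b, e⟩

lemma exists_cross {t u : ℕ} (ht : 0 < t) (hu : 0 < u) {q r : Q} (hq : ρ q = true)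
    (h : SP ρ f 0 (t + u) (q, 0) (r, t + u)) :
    ∃ d, ρ d = true ∧ SP ρ f 0 (t + u) (q, 0) (d, t) ∧ SP ρ f 0 u (d, 0) (r, u) := by
  rcases last_cross (t := t) (by omega) h with h | ⟨d, a, b, e⟩
  · exfalso
    rcases Relation.ReflTransGen.cases_head h with e | ⟨s, ⟨c', k1, k2, k3, k4, k5⟩, _⟩
    · have := congrArg Prod.snd e
      simp only at this
      omega
    · simp [OutAt, hq] at k4
      omega
  · refine ⟨d, a, b, ?_⟩
    have := SP.unshift (i := 0) (j := u) (k := t) (by simpa [add_comm] using e)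
    simpa using this

lemma cross_join {t u u' : ℕ} (huu : u ≤ u') {q d r : Q}
    (h : SP ρ f 0 (t + u) (q, 0) (d, t)) (h' : SP ρ f 0 u' (d, 0) (r, u')) :
    SP ρ f 0 (t + u') (q, 0) (r, t + u') := by
  refine (SP.mono (le_refl 0) (by omega) h).trans ?_
  have := SP.shift (k := t) h'
  simp only [zero_add] at this
  rw [add_comm t u']
  exact SP.mono (by omega) (by omega) this

lemma eventually_lr [Finite Q] (hd : IsDet f) (hp : IsPlanar ρ (· < ·) f) (q : Q)
    (hq : ρ q = true) :
    ∃ M, ∀ m, M ≤ m → ∀ r, ρ r = true →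
      (SP ρ f 0 (m+1) (q, 0) (r, m+1) ↔ SP ρ f 0 m (q, 0) (r, m)) := by
  by_cases hdom : ∀ n, ∃ r, ρ r = true ∧ SP ρ f 0 n (q, 0) (r, n)
  swap
  · push Not at hdom
    obtain ⟨M, hM⟩ := hdom
    have : ∀ m, M ≤ m → ∀ r, ρ r = true → ¬ SP ρ f 0 m (q, 0) (r, m) := by
      intro m hm r hr h
      obtain ⟨r', a, b⟩ := dom_anti' hm hq ⟨r, hr, h⟩
      exact hM r' a b
    exact ⟨M, fun m hm r hr => iff_of_false (this _ (by omega) r hr) (this _ hm r hr)⟩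
  choose s hs1 hs2 using hdom
  have suniq : ∀ n r, ρ r = true → SP ρ f 0 n (q, 0) (r, n) → s n = r := by
    intro n r hr h
    exact SP.end_unique (ρ := ρ) hd (v := (q, 0)) (n := n) (by simpa [hs1] using hs2 n)
      (by simpa [hr] using h)
  suffices H : ∃ M, ∀ m, M ≤ m → s (m+1) = s m by
    obtain ⟨M, hM⟩ := H
    refine ⟨M, fun m hm r hr => ⟨fun h => ?_, fun h => ?_⟩⟩
    · rw [← suniq _ _ hr h, hM m hm]; exact hs2 m
    · rw [← suniq _ _ hr h, ← hM m hm]; exact hs2 (m+1)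
  -- stabilisation of domains
  have hU : ∀ d : Q, ∃ n : ℕ, ρ d = true → (∃ r, ρ r = true ∧ SP ρ f 0 n (d, 0) (r, n)) →
      ∀ m, ∃ r, ρ r = true ∧ SP ρ f 0 m (d, 0) (r, m) := by
    intro d
    by_cases h : ∀ m, ∃ r, ρ r = true ∧ SP ρ f 0 m (d, 0) (r, m)
    · exact ⟨0, fun _ _ => h⟩
    · rw [not_forall] at h
      obtain ⟨m, h⟩ := h
      exact ⟨m, fun _ h' => absurd h' h⟩
  choose N hN using hU
  obtain ⟨U, hU⟩ := (Set.finite_range N).bddAbove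
  have hU' : ∀ d, N d ≤ U + 1 := fun d => (hU (Set.mem_range_self d)).trans (Nat.le_succ U)
  have hcr : ∀ t, 0 < t → ∃ d, ρ d = true ∧ SP ρ f 0 (t + (U+1)) (q, 0) (d, t) ∧
      ∀ m, ∃ r, ρ r = true ∧ SP ρ f 0 m (d, 0) (r, m) := by
    intro t ht
    obtain ⟨d, a, b, c⟩ := exists_cross ht (Nat.succ_pos U) hq (hs2 (t + (U+1)))
    exact ⟨d, a, b, hN d a (dom_anti' (hU' d) a ⟨_, hs1 _, c⟩)⟩
  obtain ⟨d1, a1, b1, c1⟩ := hcr 1 (by omega)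
  obtain ⟨d2, a2, b2, c2⟩ := hcr 2 (by omega)
  choose x1 x1r x1p using c1
  choose x2 x2r x2p using c2
  have e1 : ∀ u, U + 1 ≤ u → s (1 + u) = x1 u := fun u hu =>
    suniq _ _ (x1r u) (cross_join hu b1 (x1p u))
  have e2 : ∀ u, U + 1 ≤ u → s (2 + u) = x2 u := fun u hu =>
    suniq _ _ (x2r u) (cross_join hu b2 (x2p u))
  rcases le_total d1 d2 with h12 | h12
  · have hm : Monotone (fun k => s (U + 2 + k)) := by
      refine monotone_nat_of_le_succ fun k => ?_
      have := lr_mono hd hp (by omega) (x1r _) (x2r _) (x1p (U+1+k)) (x2p _) h12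
      rw [← e1 _ (by omega), ← e2 _ (by omega)] at this
      convert this using 2 <;> omega
    obtain ⟨n, hn⟩ := WellFoundedGT.monotone_chain_condition ⟨_, hm⟩
    refine ⟨U + 2 + n, fun m hm => ?_⟩
    have k1 := hn (m - (U + 2)) (by omega)
    have k2 := hn (m + 1 - (U + 2)) (by omega)
    simp only [OrderHom.coe_mk] at k1 k2
    rw [show U + 2 + (m - (U + 2)) = m by omega] at k1
    rw [show U + 2 + (m + 1 - (U + 2)) = m + 1 by omega] at k2
    rw [← k1, ← k2]
  · have hm : Monotone (fun k => OrderDual.toDual (s (U + 2 + k))) := by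
      refine monotone_nat_of_le_succ fun k => ?_
      have := lr_mono hd hp (by omega) (x2r _) (x1r _) (x2p (U+1+k)) (x1p _) h12
      rw [← e1 _ (by omega), ← e2 _ (by omega)] at this
      rw [OrderDual.toDual_le_toDual]
      convert this using 2 <;> omega
    obtain ⟨n, hn⟩ := WellFoundedGT.monotone_chain_condition ⟨_, hm⟩
    refine ⟨U + 2 + n, fun m hm => ?_⟩
    have k1 := hn (m - (U + 2)) (by omega)
    have k2 := hn (m + 1 - (U + 2)) (by omega)
    simp only [OrderHom.coe_mk, OrderDual.toDual_inj] at k1 k2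
    rw [show U + 2 + (m - (U + 2)) = m by omega] at k1
    rw [show U + 2 + (m + 1 - (U + 2)) = m + 1 by omega] at k2
    rw [← k1, ← k2]

lemma eventually_fwd [Finite Q] (hd : IsDet f) (hp : IsPlanar ρ (· < ·) f) (q r : Q)
    (hq : ρ q = true) :
    ∃ M, ∀ m, M ≤ m → ((q, r) ∈ glpow ρ f (m+1) ↔ (q, r) ∈ glpow ρ f m) := by
  simp only [mem_glpow_iff, hq, if_true]
  cases hr : ρ r
  · simp only [Bool.false_eq_true, if_false]
    by_cases h : ∃ m, SP ρ f 0 m (q, 0) (r, 0)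
    · obtain ⟨M, hM⟩ := h
      exact ⟨M, fun m hm => iff_of_true (hM.mono le_rfl (by omega)) (hM.mono le_rfl hm)⟩
    · rw [not_exists] at h
      exact ⟨0, fun m _ => iff_of_false (h _) (h _)⟩
  · simp only [if_true]
    obtain ⟨M, hM⟩ := eventually_lr hd hp q hq
    exact ⟨M, fun m hm => hM m hm r hr⟩

lemma eventually_all [Finite Q] (hd : IsDet f) (hp : IsPlanar ρ (· < ·) f) (p : Q × Q) :
    ∃ M, ∀ m, M ≤ m → (p ∈ glpow ρ f (m+1) ↔ p ∈ glpow ρ f m) := by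
  obtain ⟨q, r⟩ := p
  cases hq : ρ q
  · obtain ⟨M, hM⟩ := eventually_fwd (ρ := fun q => !ρ q) hd (planar_mirror hp) q r (by simp [hq])
    simp only [glpow_mirror] at hM
    exact ⟨M, hM⟩
  · exact eventually_fwd hd hp q r hq

end Order

/-- there is an `n` such that every deterministic planar
transition `f` satisfies `f^(n+1) = f^n` for the gluing composition. -/
theorem det_planar_aperiodic {Q : Type} [Fintype Q] (ρ : Q → Bool)
    (lt : Q → Q → Prop) [IsStrictTotalOrder Q lt] :
    ∃ n : ℕ, ∀ f : Set (Q × Q), IsDet f → IsPlanar ρ lt f →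
      glpow ρ f (n + 1) = glpow ρ f n := by
  classical
  letI : LinearOrder Q := linearOrderOfSTO lt
  have H : ∀ x : Set (Q × Q) × (Q × Q), ∃ M, IsDet x.1 → IsPlanar ρ lt x.1 →
      ∀ m, M ≤ m → (x.2 ∈ glpow ρ x.1 (m+1) ↔ x.2 ∈ glpow ρ x.1 m) := by
    rintro ⟨f, p⟩
    by_cases hd : IsDet f
    · by_cases hp : IsPlanar ρ lt f
      · obtain ⟨M, hM⟩ := eventually_all (ρ := ρ) hd hp p
        exact ⟨M, fun _ _ => hM⟩
      · exact ⟨0, fun _ h => absurd h hp⟩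
    · exact ⟨0, fun h => absurd h hd⟩
  choose N hN using H
  obtain ⟨U, hU⟩ := (Set.finite_range N).bddAbove
  refine ⟨U, fun f hd hp => Set.ext fun p => hN (f, p) hd hp U (hU (Set.mem_range_self _))⟩

end Planar2DFT
end

section
/- Let T be a planar deterministic two-way finite transducer with directed state set (Q,ρ) over input alphabet Σ. Then the behaviour monoid B(T), i.e. the least submonoid of B(Q,ρ) containing {⌊δ⌋(a) | a ∈ Σ}, is aperiodic. Consequently every planar deterministic two-way finite transducer computes a first-order transduction. -/
namespace Planar2DFT

section Proof
open Relation

variable {Q : Type}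

/-- Entry vertex of a tape of length `n` in state `q`. -/
def srcV (ρ : Q → Bool) (n : ℕ) (q : Q) : Q × ℕ := (q, if ρ q then 0 else n)

/-- Exit vertex of a tape of length `n` in state `q`. -/
def tgtV (ρ : Q → Bool) (n : ℕ) (q : Q) : Q × ℕ := (q, if ρ q then n else 0)

/-- Edges of the graph obtained by gluing a whole list of transition profiles. -/
def TEdge (ρ : Q → Bool) (w : List (Set (Q × Q))) (x y : Q × ℕ) : Prop :=
  ∃ i f p, w[i]? = some f ∧ p ∈ f ∧ x = (p.1, if ρ p.1 then i else i + 1) ∧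
    y = (p.2, if ρ p.2 then i + 1 else i)

/-- The behaviour of a list of transitions. -/
def beh (ρ : Q → Bool) (w : List (Set (Q × Q))) : Set (Q × Q) :=
  {p | ReflTransGen (TEdge ρ w) (srcV ρ w.length p.1) (tgtV ρ w.length p.2)}

theorem glueEdge_iff (ρ : Q → Bool) (f g : Set (Q × Q)) (x y : Q × Fin 3) :
    GlueEdge ρ f g x y ↔
      (∃ p ∈ f, x = (p.1, if ρ p.1 then 0 else 1) ∧ y = (p.2, if ρ p.2 then 1 else 0)) ∨
      (∃ p ∈ g, x = (p.1, if ρ p.1 then 1 else 2) ∧ y = (p.2, if ρ p.2 then 2 else 1)) := by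
  obtain ⟨x1, x2⟩ := x
  obtain ⟨y1, y2⟩ := y
  simp only [GlueEdge, ProfileEdge, Prod.mk.injEq]
  constructor
  · rintro (⟨h1, h2, p, hp, ⟨h3, h4⟩, h5, h6⟩ | ⟨h1, h2, p, hp, ⟨h3, h4⟩, h5, h6⟩)
    · left
      refine ⟨p, hp, ⟨h3, ?_⟩, h5, ?_⟩
      · cases h : ρ p.1 <;> fin_cases x2 <;> simp_all
      · cases h : ρ p.2 <;> fin_cases y2 <;> simp_all
    · right
      refine ⟨p, hp, ⟨h3, ?_⟩, h5, ?_⟩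
      · cases h : ρ p.1 <;> fin_cases x2 <;> simp_all
      · cases h : ρ p.2 <;> fin_cases y2 <;> simp_all
  · rintro (⟨p, hp, ⟨h3, h4⟩, h5, h6⟩ | ⟨p, hp, ⟨h3, h4⟩, h5, h6⟩)
    · left
      refine ⟨?_, ?_, p, hp, ⟨h3, ?_⟩, h5, ?_⟩
      · subst h4; split <;> decide
      · subst h6; split <;> decide
      · subst h4; cases ρ p.1 <;> simp
      · subst h6; cases ρ p.2 <;> simp
    · right
      refine ⟨?_, ?_, p, hp, ⟨h3, ?_⟩, h5, ?_⟩
      · subst h4; split <;> decide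
      · subst h6; split <;> decide
      · subst h4; cases ρ p.1 <;> simp
      · subst h6; cases ρ p.2 <;> simp

theorem TEdge.left {ρ : Q → Bool} {u v : List (Set (Q × Q))} {x y : Q × ℕ}
    (h : TEdge ρ u x y) : TEdge ρ (u ++ v) x y := by
  obtain ⟨i, f, p, hi, hp, hx, hy⟩ := h
  exact ⟨i, f, p, by grind, hp, hx, hy⟩

theorem TEdge.right {ρ : Q → Bool} {u v : List (Set (Q × Q))} {x y : Q × ℕ}
    (h : TEdge ρ v x y) :
    TEdge ρ (u ++ v) (x.1, x.2 + u.length) (y.1, y.2 + u.length) := by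
  obtain ⟨i, f, p, hi, hp, hx, hy⟩ := h
  refine ⟨i + u.length, f, p, by grind, hp, ?_, ?_⟩
  · subst hx; simp; split <;> omega
  · subst hy; simp; split <;> omega

theorem TEdge.le {ρ : Q → Bool} {w : List (Set (Q × Q))} {x y : Q × ℕ}
    (h : TEdge ρ w x y) : y.2 ≤ w.length := by
  obtain ⟨i, f, p, hi, hp, hx, hy⟩ := h
  have : i < w.length := by grind
  subst hy; simp; split <;> omega

theorem srcV_le (ρ : Q → Bool) (n : ℕ) (q : Q) : (srcV ρ n q).2 ≤ n := by
  simp only [srcV]; split <;> omega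

theorem path_le {ρ : Q → Bool} {w : List (Set (Q × Q))} {x y : Q × ℕ}
    (h : ReflTransGen (TEdge ρ w) x y) (hx : x.2 ≤ w.length) : y.2 ≤ w.length := by
  induction h with
  | refl => exact hx
  | tail _ h _ => exact h.le

theorem beh_nil (ρ : Q → Bool) : beh ρ [] = idRel Q := by
  ext ⟨q, r⟩
  simp only [beh, idRel, Set.mem_ofPred_eq]
  constructor
  · intro h
    rcases ReflTransGen.cases_head h with h | ⟨c, h, _⟩
    · simp [srcV, tgtV] at h; exact h
    · obtain ⟨i, f, p, hi, _⟩ := h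
      simp at hi
  · rintro rfl
    have : srcV ρ (List.length ([] : List (Set (Q × Q)))) q = tgtV ρ 0 q := by simp [srcV, tgtV]
    rw [this]; exact ReflTransGen.refl

theorem tgt_no_edge {ρ : Q → Bool} {w : List (Set (Q × Q))} {r : Q} {y : Q × ℕ}
    (h : TEdge ρ w (tgtV ρ w.length r) y) : False := by
  obtain ⟨i, f, p, hi, hp, hx, hy⟩ := h
  have : i < w.length := by grind
  simp only [tgtV, Prod.mk.injEq] at hx
  obtain ⟨rfl, hx⟩ := hx
  split at hx <;> omega

theorem src_no_edge {ρ : Q → Bool} {w : List (Set (Q × Q))} {r : Q} {y : Q × ℕ}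
    (h : TEdge ρ w y (srcV ρ w.length r)) : False := by
  obtain ⟨i, f, p, hi, hp, hx, hy⟩ := h
  have : i < w.length := by grind
  simp only [srcV, Prod.mk.injEq] at hy
  obtain ⟨rfl, hy⟩ := hy
  split at hy <;> omega

theorem beh_single (ρ : Q → Bool) (f : Set (Q × Q)) : beh ρ [f] = f := by
  ext ⟨q, r⟩
  simp only [beh, Set.mem_ofPred_eq]
  constructor
  · intro h
    rcases ReflTransGen.cases_head h with h | ⟨c, h, h'⟩
    · simp only [srcV, tgtV, List.length_singleton, Prod.mk.injEq] at h
      obtain ⟨rfl, h⟩ := h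
      split at h <;> omega
    · obtain ⟨i, f', p, hi, hp, hx, hy⟩ := h
      obtain rfl : i = 0 := by grind
      simp at hi
      subst hi
      have hc : c = tgtV ρ [f].length p.2 := by rw [hy]; rfl
      rcases ReflTransGen.cases_head h' with h' | ⟨d, h', _⟩
      · rw [hy] at h'
        simp only [srcV, tgtV, Prod.mk.injEq] at hx h'
        rw [hx.1, ← h'.1]; exact hp
      · rw [hc] at h'
        exact (tgt_no_edge h').elim
  · intro h
    exact ReflTransGen.single ⟨0, f, (q, r), by simp, h, rfl, rfl⟩

theorem glue_beh (ρ : Q → Bool) (u v : List (Set (Q × Q))) :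
    glue ρ (beh ρ u) (beh ρ v) = beh ρ (u ++ v) := by
  ext ⟨q, r⟩
  constructor
  · intro h
    have key := ReflTransGen.lift' (p := TEdge ρ (u ++ v)) (r := GlueEdge ρ (beh ρ u) (beh ρ v))
      (fun x : Q × Fin 3 => ((x.1, if x.2 = 0 then 0 else if x.2 = 1 then u.length else
        u.length + v.length) : Q × ℕ)) (fun x y hxy => ?_) _ _ h
    · simp only [beh, srcV, tgtV, Set.mem_ofPred_eq, List.length_append]
      convert key using 2
      · cases ρ q <;> simp
      · cases ρ r <;> simp
    · rw [glueEdge_iff] at hxy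
      rcases hxy with ⟨p, hp, rfl, rfl⟩ | ⟨p, hp, rfl, rfl⟩
      · have := ReflTransGen.mono (fun _ _ h => TEdge.left (v := v) h) _ _ hp
        convert this using 1
        · simp only [srcV]; cases ρ p.1 <;> simp
        · simp only [tgtV]; cases ρ p.2 <;> simp
      · have := ReflTransGen.lift (fun x : Q × ℕ => (x.1, x.2 + u.length))
          (fun _ _ h => TEdge.right (u := u) h) _ _ hp
        simp only [Function.onFun] at this ⊢
        convert this using 1
        · simp only [srcV]; cases ρ p.1 <;> simp [add_comm]
        · simp only [tgtV]; cases ρ p.2 <;> simp [add_comm]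
  · intro h
    simp only [beh, Set.mem_ofPred_eq] at h
    set st : Q × Fin 3 := (q, if ρ q then 0 else 2) with hst
    set G := GlueEdge ρ (beh ρ u) (beh ρ v) with hG
    have gl : ∀ s t, (s, t) ∈ beh ρ u →
        G (s, if ρ s then 0 else 1) (t, if ρ t then 1 else 0) := fun s t hs =>
      (glueEdge_iff _ _ _ _ _).2 (Or.inl ⟨(s, t), hs, rfl, rfl⟩)
    have gr : ∀ s t, (s, t) ∈ beh ρ v →
        G (s, if ρ s then 1 else 2) (t, if ρ t then 2 else 1) := fun s t hs =>
      (glueEdge_iff _ _ _ _ _).2 (Or.inr ⟨(s, t), hs, rfl, rfl⟩)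
    have inv : ∀ y, ReflTransGen (TEdge ρ (u ++ v)) (srcV ρ (u ++ v).length q) y →
        (∃ s, ReflTransGen G st (s, if ρ s then 0 else 1) ∧
          ReflTransGen (TEdge ρ u) (srcV ρ u.length s) y) ∨
        (∃ s y', ReflTransGen G st (s, if ρ s then 1 else 2) ∧
          ReflTransGen (TEdge ρ v) (srcV ρ v.length s) y' ∧ y = (y'.1, y'.2 + u.length)) := by
      intro y hy
      induction hy with
      | refl =>
        cases hq : ρ q
        · right
          refine ⟨q, (q, v.length), ?_, ?_, ?_⟩
          · rw [hst, hq]; exact ReflTransGen.refl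
          · simp only [srcV, hq]; exact ReflTransGen.refl
          · simp [srcV, hq, add_comm]
        · left
          refine ⟨q, ?_, ?_⟩
          · rw [hst, hq]; exact ReflTransGen.refl
          · simp only [srcV, hq]; exact ReflTransGen.refl
      | @tail y z hy hyz ih =>
        obtain ⟨i, f, p, hi, hp, hx, hz⟩ := hyz
        by_cases hiu : i < u.length
        · have e : TEdge ρ u y z := ⟨i, f, p, by grind, hp, hx, hz⟩
          left
          rcases ih with ⟨s, h1, h2⟩ | ⟨s, y', h1, h2, h3⟩
          · exact ⟨s, h1, h2.tail e⟩
          · rw [hx] at h3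
            simp only [Prod.mk.injEq] at h3
            cases hr : ρ p.1
            · simp only [hr] at h3
              have hy' : y' = tgtV ρ v.length p.1 := by
                apply Prod.ext
                · simp [tgtV, h3.1]
                · simp [tgtV, hr] at h3 ⊢; omega
              have hsp : (s, p.1) ∈ beh ρ v := by
                simp only [beh, Set.mem_ofPred_eq]; rw [← hy']; exact h2
              refine ⟨p.1, ?_, ?_⟩
              · have := h1.tail (gr _ _ hsp)
                rw [hr] at this ⊢; exact this
              · have hys : y = srcV ρ u.length p.1 := by
                  rw [hx]; simp [srcV, hr] at h3 ⊢; omega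
                rw [← hys]; exact ReflTransGen.single e
            · simp [hr] at h3; omega
        · have e : TEdge ρ v (y.1, y.2 - u.length) (z.1, z.2 - u.length) := by
            refine ⟨i - u.length, f, p, by grind, hp, ?_, ?_⟩
            · rw [hx]; simp; split <;> omega
            · rw [hz]; simp; split <;> omega
          have hz' : z = ((z.1, z.2 - u.length).1, (z.1, z.2 - u.length).2 + u.length) := by
            apply Prod.ext
            · rfl
            · rw [hz]; simp; split <;> omega
          right
          rcases ih with ⟨s, h1, h2⟩ | ⟨s, y', h1, h2, h3⟩
          · have hle := path_le h2 (srcV_le _ _ _)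
            cases hr : ρ p.1
            · rw [hx] at hle; simp [hr] at hle; omega
            · have hil : i = u.length := by
                rw [hx] at hle; simp [hr] at hle; omega
              have hyt : y = tgtV ρ u.length p.1 := by
                rw [hx]; simp [tgtV, hr, hil]
              have hsp : (s, p.1) ∈ beh ρ u := by
                simp only [beh, Set.mem_ofPred_eq]; rw [← hyt]; exact h2
              refine ⟨p.1, _, ?_, ?_, hz'⟩
              · have := h1.tail (gl _ _ hsp)
                rw [hr] at this ⊢; exact this
              · have hys : (y.1, y.2 - u.length) = srcV ρ v.length p.1 := by
                  rw [hyt]; simp [srcV, tgtV, hr]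
                rw [← hys]; exact ReflTransGen.single e
          · refine ⟨s, _, h1, h2.tail ?_, hz'⟩
            have : y' = (y.1, y.2 - u.length) := by rw [h3]; simp
            rw [this]; exact e
    show ReflTransGen G st (r, if ρ r then 2 else 0)
    rcases inv _ h with ⟨s, h1, h2⟩ | ⟨s, y', h1, h2, h3⟩
    · cases hr : ρ r
      · have : tgtV ρ (u ++ v).length r = tgtV ρ u.length r := by simp [tgtV, hr]
        rw [this] at h2
        have := h1.tail (gl _ _ h2)
        rw [hr] at this; exact this
      · have hle := path_le h2 (srcV_le _ _ _)
        simp [tgtV, hr] at hle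
        subst hle
        have h3 := h1.tail (gl s r (by simpa [beh] using h2))
        have h4 := h3.tail (c := (r, 2)) (by
          have := gr r r (by rw [beh_nil]; rfl)
          simpa [hr] using this)
        exact h4
    · cases hr : ρ r
      · simp [tgtV, hr] at h3
        have hu : u = [] := by
          apply List.eq_nil_of_length_eq_zero
          omega
        have hy' : y' = tgtV ρ v.length r := by
          apply Prod.ext
          · simp [tgtV]; exact h3.1.symm
          · simp [tgtV, hr]; omega
        rw [hy'] at h2
        have h3 := h1.tail (gr s r h2)
        have h4 := h3.tail (c := (r, 0)) (by
          have := gl r r (by rw [hu, beh_nil]; rfl)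
          simpa [hr] using this)
        exact h4
      · have hy' : y' = tgtV ρ v.length r := by
          simp [tgtV, hr, Prod.ext_iff] at h3 ⊢
          exact ⟨h3.1.symm, by omega⟩
        rw [hy'] at h2
        have := h1.tail (gr _ _ h2)
        rw [hr] at this; exact this

theorem tedge_unique {ρ : Q → Bool} {w : List (Set (Q × Q))} (hw : ∀ f ∈ w, IsDet f) :
    Relator.RightUnique (TEdge ρ w) := by
  rintro a b c ⟨i, f, p, hi, hp, hx, hy⟩ ⟨i', f', p', hi', hp', hx', hy'⟩
  rw [hx] at hx'
  simp only [Prod.mk.injEq] at hx'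
  obtain ⟨h1, h2⟩ := hx'
  rw [← h1] at h2
  have hii : i = i' := by split at h2 <;> omega
  subst hii
  have hff : f = f' := by rw [hi] at hi'; exact Option.some.inj hi'
  subst hff
  have h3 : p.2 = p'.2 := hw f (List.mem_of_getElem? hi) p.1 p.2 p'.2 hp (by rw [h1]; exact hp')
  rw [hy, hy', h3]

theorem reach_tgt {ρ : Q → Bool} {w : List (Set (Q × Q))} (hw : ∀ f ∈ w, IsDet f)
    {u y : Q × ℕ} {r : Q} (h1 : ReflTransGen (TEdge ρ w) u y)
    (h2 : ReflTransGen (TEdge ρ w) u (tgtV ρ w.length r)) :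
    ReflTransGen (TEdge ρ w) y (tgtV ρ w.length r) := by
  rcases ReflTransGen.total_of_right_unique (tedge_unique hw) h1 h2 with h | h
  · exact h
  · rcases ReflTransGen.cases_head h with h | ⟨c, h, _⟩
    · rw [h]
    · exact (tgt_no_edge h).elim

theorem tgt_unique {ρ : Q → Bool} {w : List (Set (Q × Q))} (hw : ∀ f ∈ w, IsDet f)
    {u : Q × ℕ} {r r' : Q} (h1 : ReflTransGen (TEdge ρ w) u (tgtV ρ w.length r))
    (h2 : ReflTransGen (TEdge ρ w) u (tgtV ρ w.length r')) : r = r' := by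
  rcases ReflTransGen.cases_head (reach_tgt hw h1 h2) with h | ⟨c, h, _⟩
  · exact congrArg Prod.fst h
  · exact (tgt_no_edge h).elim

theorem beh_det {ρ : Q → Bool} {w : List (Set (Q × Q))} (hw : ∀ f ∈ w, IsDet f) :
    IsDet (beh ρ w) := fun _ _ _ h1 h2 => tgt_unique hw h1 h2

/-- The cell through which a path enters a vertex. -/
def enterC (ρ : Q → Bool) (y : Q × ℕ) : ℕ := if ρ y.1 then y.2 else y.2 + 1

/-- The cell through which a path leaves a vertex. -/
def leaveC (ρ : Q → Bool) (y : Q × ℕ) : ℕ := if ρ y.1 then y.2 + 1 else y.2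

/-- Incidence of a vertex with a cell, mod 2. -/
def wt (ρ : Q → Bool) (j : ℕ) (y : Q × ℕ) : ZMod 2 :=
  (if enterC ρ y = j then 1 else 0) + (if leaveC ρ y = j then 1 else 0)

theorem path_list {ρ : Q → Bool} {w : List (Set (Q × Q))} {u x : Q × ℕ}
    (h : ReflTransGen (TEdge ρ w) u x) :
    ∃ l : List (Q × ℕ), ∀ (j : ℕ) (φ : Q × ℕ → ZMod 2),
      (∀ a b, ReflTransGen (TEdge ρ w) u a → TEdge ρ w a b → leaveC ρ a = j → φ a = φ b) →
      (l.map (fun y => wt ρ j y * φ y)).sum =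
        (if enterC ρ u = j then φ u else 0) + (if leaveC ρ x = j then φ x else 0) := by
  induction h with
  | refl =>
    refine ⟨[u], fun j φ _ => ?_⟩
    simp [wt, add_mul]
  | @tail x z hx hz ih =>
    obtain ⟨l, hl⟩ := ih
    refine ⟨l ++ [z], fun j φ hφ => ?_⟩
    rw [List.map_append, List.sum_append, hl j φ hφ]
    have hc : leaveC ρ x = enterC ρ z := by
      obtain ⟨i, f, p, hi, hp, h1, h2⟩ := hz
      rw [h1, h2]; simp only [leaveC, enterC]; split <;> split <;> rfl
    have h2 : ∀ t : ZMod 2, t + t = 0 := by decide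
    have h3 := hφ x z hx hz
    simp only [List.map_cons, List.map_nil, List.sum_cons, List.sum_nil, add_zero, wt, add_mul,
      ite_mul, one_mul, zero_mul]
    rw [hc] at h3 ⊢
    by_cases hj : enterC ρ z = j
    · simp only [hj, if_true, h3 hj]
      rw [← add_assoc, add_assoc _ (φ z) (φ z), h2, add_zero]
    · simp [hj]

/-- `y` lies strictly below `z` in the same column (mod 2 indicator). -/
def below (rk : Q → ℕ) (y z : Q × ℕ) : ZMod 2 :=
  if y.2 = z.2 ∧ rk y.1 < rk z.1 then 1 else 0

/-- Integer coordinate of a boundary vertex, for the extended order. -/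
def extVal (rk : Q → ℕ) (x : Q × Bool) : ℤ := if x.2 then (rk x.1 : ℤ) + 1 else - (rk x.1 : ℤ) - 1

theorem extLt_of {lt : Q → Q → Prop} {rk : Q → ℕ} (hrk : ∀ a b, lt a b ↔ rk a < rk b)
    {x y : Q × Bool} (h : extVal rk x < extVal rk y) : ExtLt lt x y := by
  obtain ⟨x1, x2⟩ := x
  obtain ⟨y1, y2⟩ := y
  simp only [ExtLt, hrk]
  cases x2 <;> cases y2 <;> simp [extVal] at h ⊢ <;> omega

theorem chord {ρ : Q → Bool} {lt : Q → Q → Prop} {rk : Q → ℕ}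
    (hrk : ∀ a b, lt a b ↔ rk a < rk b) (hinj : Function.Injective rk)
    {f : Set (Q × Q)} (hf : IsPlanar ρ lt f) {p p' : Q × Q} (hp : p ∈ f) (hp' : p' ∈ f) (i : ℕ)
    {a b c d : Q × ℕ}
    (ha : a = (p.1, if ρ p.1 then i else i + 1)) (hb : b = (p.2, if ρ p.2 then i + 1 else i))
    (hc : c = (p'.1, if ρ p'.1 then i else i + 1)) (hd : d = (p'.2, if ρ p'.2 then i + 1 else i))
    (hac : a ≠ c) (had : a ≠ d) (hbc : b ≠ c) (hbd : b ≠ d) :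
    below rk a c + below rk a d = below rk b c + below rk b d := by
  have e1 : ProfileEdge ρ f (p.1, !ρ p.1) (p.2, ρ p.2) := ⟨p, hp, rfl, rfl⟩
  have e2 : ProfileEdge ρ f (p'.1, !ρ p'.1) (p'.2, ρ p'.2) := ⟨p', hp', rfl, rfl⟩
  have nc : ∀ u r v s : Q × Bool, (ProfileEdge ρ f u v ∨ ProfileEdge ρ f v u) →
      (ProfileEdge ρ f r s ∨ ProfileEdge ρ f s r) →
      ¬ (extVal rk u < extVal rk r ∧ extVal rk r < extVal rk v ∧ extVal rk v < extVal rk s) :=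
    fun u r v s h1 h2 h => hf ⟨u, r, v, s, extLt_of hrk h.1, extLt_of hrk h.2.1,
      extLt_of hrk h.2.2, h1, h2⟩
  have n1 := nc _ _ _ _ (Or.inl e1) (Or.inl e2)
  have n2 := nc _ _ _ _ (Or.inl e1) (Or.inr e2)
  have n3 := nc _ _ _ _ (Or.inr e1) (Or.inl e2)
  have n4 := nc _ _ _ _ (Or.inr e1) (Or.inr e2)
  have n5 := nc _ _ _ _ (Or.inl e2) (Or.inl e1)
  have n6 := nc _ _ _ _ (Or.inl e2) (Or.inr e1)
  have n7 := nc _ _ _ _ (Or.inr e2) (Or.inl e1)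
  have n8 := nc _ _ _ _ (Or.inr e2) (Or.inr e1)
  clear nc e1 e2
  have ne : ∀ x y : Q × ℕ, x ≠ y → ¬ (x.2 = y.2 ∧ rk x.1 = rk y.1) :=
    fun x y h h' => h (Prod.ext (hinj h'.2) h'.1)
  replace hac := ne _ _ hac
  replace had := ne _ _ had
  replace hbc := ne _ _ hbc
  replace hbd := ne _ _ hbd
  subst ha hb hc hd
  clear ne hf hp hp' hrk hinj
  cases h1 : ρ p.1 <;> cases h2 : ρ p.2 <;> cases h3 : ρ p'.1 <;> cases h4 : ρ p'.2 <;>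
    simp [extVal, below, h1, h2, h3, h4] at * <;>
    split_ifs <;> first | rfl | (exfalso; omega)

theorem beh_mono {ρ : Q → Bool} {lt : Q → Q → Prop} {rk : Q → ℕ}
    (hrk : ∀ a b, lt a b ↔ rk a < rk b) (hinj : Function.Injective rk)
    {w : List (Set (Q × Q))} (hw : ∀ f ∈ w, IsDet f) (hpl : ∀ f ∈ w, IsPlanar ρ lt f)
    {q r q' r' : Q} (h : (q, r) ∈ beh ρ w) (h' : (q', r') ∈ beh ρ w)
    (h1 : ρ q' = ρ q) (h2 : ρ r = ρ q) (h3 : ρ r' = ρ q) (hne : r ≠ r') :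
    rk q < rk q' ↔ rk r < rk r' := by
  simp only [beh, Set.mem_ofPred_eq] at h h'
  obtain ⟨l, hl⟩ := path_list h
  have hzero : ∀ j (φ : Q × ℕ → ZMod 2), (∀ y, wt ρ j y ≠ 1 → φ y = 0) →
      l.map (fun y => wt ρ j y * φ y) = l.map φ := by
    intro j φ hφ
    apply List.map_congr_left
    intro y _
    by_cases hy : wt ρ j y = 1
    · rw [hy, one_mul]
    · rw [hφ y hy, mul_zero]
  have hwt : ∀ (j : ℕ) (y : Q × ℕ), (y.2 = j ∨ y.2 + 1 = j) → wt ρ j y = 1 := by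
    intro j y hy
    simp only [wt, enterC, leaveC]
    rcases hy with hy | hy <;> subst hy <;> by_cases hyy : ρ y.1 = true <;> simp [hyy]
  have hdisj : ∀ y y', ReflTransGen (TEdge ρ w) (srcV ρ w.length q) y →
      ReflTransGen (TEdge ρ w) (srcV ρ w.length q') y' → y ≠ y' := by
    rintro y y' hy hy' rfl
    exact hne (tgt_unique hw (reach_tgt hw hy h) (reach_tgt hw hy' h'))
  have hconst : ∀ y, ReflTransGen (TEdge ρ w) (srcV ρ w.length q') y →
      (l.map (fun z => below rk z (srcV ρ w.length q'))).sum =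
        (l.map (fun z => below rk z y)).sum := by
    intro y hy
    induction hy with
    | refl => rfl
    | @tail c d hc hcd ih =>
      rw [ih]
      have hd := hc.tail hcd
      obtain ⟨i, f, p', hi, hp', hx, hy⟩ := hcd
      have hin : i < w.length := by grind
      have key := hl (i + 1) (fun z => below rk z c + below rk z d) (by
        intro a b ha hab hl'
        have hb := ha.tail hab
        obtain ⟨i', f', p, hi', hp, hx', hy'⟩ := hab
        have : i' = i := by
          rw [hx'] at hl'; simp only [leaveC] at hl'; split at hl' <;> omega
        subst this
        have hff : f' = f := by rw [hi] at hi'; exact (Option.some.inj hi').symm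
        subst hff
        exact chord hrk hinj (hpl _ (List.mem_of_getElem? hi)) hp hp' i' hx' hy' hx hy
          (hdisj _ _ ha hc) (hdisj _ _ ha hd) (hdisj _ _ hb hc) (hdisj _ _ hb hd))
      rw [hzero] at key
      · rw [List.sum_map_add] at key
        have e1 : enterC ρ (srcV ρ w.length q) ≠ i + 1 := by
          simp only [enterC, srcV]; split <;> omega
        have e2 : leaveC ρ (tgtV ρ w.length r) ≠ i + 1 := by
          simp only [leaveC, tgtV]; split <;> omega
        rw [if_neg e1, if_neg e2, add_zero] at key
        have : ∀ s t : ZMod 2, s + t = 0 → s = t := by decide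
        exact this _ _ key
      · intro y hwy
        have hy1 : y.2 ≠ i + 1 := fun h => hwy (hwt _ _ (Or.inl h))
        have hy2 : y.2 ≠ i := fun h => hwy (hwt _ _ (Or.inr (by omega)))
        have hc2 : y.2 ≠ c.2 := by rw [hx]; simp; split <;> omega
        have hd2 : y.2 ≠ d.2 := by rw [hy]; simp; split <;> omega
        simp [below, hc2, hd2]
  have hfin := hconst _ h'
  have hL : ∀ t : Q, (l.map (fun z => below rk z (t, 0))).sum =
      if rk (if ρ q then q else r) < rk t then 1 else 0 := by
    intro t
    have key := hl 0 (fun z => below rk z (t, 0)) (by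
      intro a b _ hab hl'
      obtain ⟨i', f', p, hi', hp, hx', hy'⟩ := hab
      rw [hx'] at hl'; simp only [leaveC] at hl'; split at hl' <;> omega)
    rw [hzero] at key
    · rw [key]
      cases hq : ρ q <;> simp [enterC, leaveC, srcV, tgtV, h2, hq, below]
    · intro y hwy
      have hy1 : y.2 ≠ 0 := fun h => hwy (hwt _ _ (Or.inl h))
      simp [below, hy1]
  have hR : ∀ t : Q, (l.map (fun z => below rk z (t, w.length))).sum =
      if rk (if ρ q then r else q) < rk t then 1 else 0 := by
    intro t
    have key := hl (w.length + 1) (fun z => below rk z (t, w.length)) (by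
      intro a b _ hab hl'
      obtain ⟨i', f', p, hi', hp, hx', hy'⟩ := hab
      have hin : i' < w.length := by grind
      rw [hx'] at hl'; simp only [leaveC] at hl'; split at hl' <;> omega)
    rw [hzero] at key
    · rw [key]
      cases hq : ρ q <;> simp [enterC, leaveC, srcV, tgtV, h2, hq, below]
    · intro y hwy
      have hy1 : y.2 ≠ w.length := fun h => hwy (hwt _ _ (Or.inr (by omega)))
      simp [below, hy1]
  have hfin' : (if rk q < rk q' then (1 : ZMod 2) else 0) = if rk r < rk r' then 1 else 0 := by
    cases hq : ρ q
    · simp only [srcV, tgtV, h1, h3, hq] at hfin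
      have a1 := hR q'
      have a2 := hL r'
      simp only [hq] at a1 a2
      simpa using a1.symm.trans (hfin.trans a2)
    · simp only [srcV, tgtV, h1, h3, hq] at hfin
      have a1 := hL q'
      have a2 := hR r'
      simp only [hq] at a1 a2
      simpa using a1.symm.trans (hfin.trans a2)
  by_cases a : rk q < rk q' <;> by_cases b : rk r < rk r' <;> simp [a, b] at hfin' ⊢

theorem glue_assoc_words (ρ : Q → Bool) (f : Set (Q × Q)) (k : ℕ) :
    glpow ρ f k = beh ρ (List.replicate k f) := by
  induction k with
  | zero => exact (beh_nil ρ).symm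
  | succ n ih =>
    rw [List.replicate_succ', ← glue_beh, beh_single, ← ih]; rfl

theorem glue_LL {ρ : Q → Bool} {f g : Set (Q × Q)} {q r : Q} (hq : ρ q = true) (hr : ρ r = false)
    (h : (q, r) ∈ f) : (q, r) ∈ glue ρ f g := by
  refine ReflTransGen.single ((glueEdge_iff _ _ _ _ _).2 (Or.inl ⟨(q, r), h, ?_, ?_⟩))
  · simp [hq]
  · simp [hr]

theorem glue_RR {ρ : Q → Bool} {f g : Set (Q × Q)} {q r : Q} (hq : ρ q = false) (hr : ρ r = true)
    (h : (q, r) ∈ g) : (q, r) ∈ glue ρ f g := by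
  refine ReflTransGen.single ((glueEdge_iff _ _ _ _ _).2 (Or.inr ⟨(q, r), h, ?_, ?_⟩))
  · simp [hq]
  · simp [hr]

theorem glue_F_ker {ρ : Q → Bool} {f g : Set (Q × Q)} {q r : Q} (hq : ρ q = true)
    (hr : ρ r = true) (h : (q, r) ∈ glue ρ f g) :
    ∃ s, ρ s = true ∧ (q, s) ∈ f ∧ ∀ q', ρ q' = true → (q', s) ∈ f → (q', r) ∈ glue ρ f g := by
  simp only [glue, Set.mem_ofPred_eq, hq, hr, if_true] at h
  rcases ReflTransGen.cases_head h with h | ⟨c, h1, h2⟩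
  · simp at h
  · rw [glueEdge_iff] at h1
    rcases h1 with ⟨p, hp, hx, hc⟩ | ⟨p, hp, hx, hc⟩
    · simp only [Prod.mk.injEq] at hx
      cases hs : ρ p.2
      · rcases ReflTransGen.cases_head h2 with h | ⟨d, h, _⟩
        · rw [hc] at h; simp [hs] at h
        · rw [glueEdge_iff] at h
          rcases h with ⟨p', _, hx', _⟩ | ⟨p', _, hx', _⟩
          · rw [hc] at hx'; simp only [Prod.mk.injEq] at hx'
            rw [← hx'.1] at hx'; simp [hs] at hx'
          · rw [hc] at hx'; simp only [Prod.mk.injEq] at hx'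
            rw [← hx'.1] at hx'; simp [hs] at hx'
      · refine ⟨p.2, hs, by rw [hx.1]; exact hp, fun q' hq' hq's => ?_⟩
        simp only [glue, Set.mem_ofPred_eq, hq', hr, if_true]
        refine ReflTransGen.head ((glueEdge_iff _ _ _ _ _).2
          (Or.inl ⟨(q', p.2), hq's, ?_, hc⟩)) h2
        simp [hq']
    · simp only [Prod.mk.injEq] at hx
      rw [← hx.1] at hx; simp [hq] at hx

theorem glue_B_ker {ρ : Q → Bool} {f g : Set (Q × Q)} {q r : Q} (hq : ρ q = false)
    (hr : ρ r = false) (h : (q, r) ∈ glue ρ f g) :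
    ∃ s, ρ s = false ∧ (q, s) ∈ g ∧ ∀ q', ρ q' = false → (q', s) ∈ g → (q', r) ∈ glue ρ f g := by
  simp only [glue, Set.mem_ofPred_eq, hq, hr] at h
  rcases ReflTransGen.cases_head h with h | ⟨c, h1, h2⟩
  · simp at h
  · rw [glueEdge_iff] at h1
    rcases h1 with ⟨p, hp, hx, hc⟩ | ⟨p, hp, hx, hc⟩
    · simp only [Prod.mk.injEq] at hx
      rw [← hx.1] at hx; simp [hq] at hx
    · simp only [Prod.mk.injEq] at hx
      cases hs : ρ p.2
      · refine ⟨p.2, hs, by rw [hx.1]; exact hp, fun q' hq' hq's => ?_⟩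
        simp only [glue, Set.mem_ofPred_eq, hq', hr]
        refine ReflTransGen.head ((glueEdge_iff _ _ _ _ _).2
          (Or.inr ⟨(q', p.2), hq's, ?_, hc⟩)) h2
        simp [hq']
      · rcases ReflTransGen.cases_head h2 with h | ⟨d, h, _⟩
        · rw [hc] at h; simp [hs] at h
        · rw [glueEdge_iff] at h
          rcases h with ⟨p', _, hx', _⟩ | ⟨p', _, hx', _⟩
          · rw [hc] at hx'; simp only [Prod.mk.injEq] at hx'
            rw [← hx'.1] at hx'; simp [hs] at hx'
          · rw [hc] at hx'; simp only [Prod.mk.injEq] at hx'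
            rw [← hx'.1] at hx'; simp [hs] at hx'

theorem glue_F_im {ρ : Q → Bool} {f g : Set (Q × Q)} {q r : Q} (hq : ρ q = true)
    (hr : ρ r = true) (h : (q, r) ∈ glue ρ f g) : ∃ q', ρ q' = true ∧ (q', r) ∈ g := by
  simp only [glue, Set.mem_ofPred_eq, hq, hr, if_true] at h
  rcases ReflTransGen.cases_tail h with h | ⟨c, h2, h1⟩
  · simp at h
  · rw [glueEdge_iff] at h1
    rcases h1 with ⟨p, hp, hc, hx⟩ | ⟨p, hp, hc, hx⟩
    · simp only [Prod.mk.injEq] at hx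
      rw [← hx.1] at hx; simp [hr] at hx
    · simp only [Prod.mk.injEq] at hx
      cases hs : ρ p.1
      · rcases ReflTransGen.cases_tail h2 with h | ⟨d, _, h⟩
        · rw [hc] at h; simp [hs] at h
        · rw [glueEdge_iff] at h
          rcases h with ⟨p', _, _, hx'⟩ | ⟨p', _, _, hx'⟩
          · rw [hc] at hx'; simp only [Prod.mk.injEq] at hx'
            rw [← hx'.1] at hx'; simp [hs] at hx'
          · rw [hc] at hx'; simp only [Prod.mk.injEq] at hx'
            rw [← hx'.1] at hx'; simp [hs] at hx'
      · exact ⟨p.1, hs, by rw [hx.1]; exact hp⟩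

theorem glue_B_im {ρ : Q → Bool} {f g : Set (Q × Q)} {q r : Q} (hq : ρ q = false)
    (hr : ρ r = false) (h : (q, r) ∈ glue ρ f g) : ∃ q', ρ q' = false ∧ (q', r) ∈ f := by
  simp only [glue, Set.mem_ofPred_eq, hq, hr] at h
  rcases ReflTransGen.cases_tail h with h | ⟨c, h2, h1⟩
  · simp at h
  · rw [glueEdge_iff] at h1
    rcases h1 with ⟨p, hp, hc, hx⟩ | ⟨p, hp, hc, hx⟩
    · simp only [Prod.mk.injEq] at hx
      cases hs : ρ p.1
      · exact ⟨p.1, hs, by rw [hx.1]; exact hp⟩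
      · rcases ReflTransGen.cases_tail h2 with h | ⟨d, _, h⟩
        · rw [hc] at h; simp [hs] at h
        · rw [glueEdge_iff] at h
          rcases h with ⟨p', _, _, hx'⟩ | ⟨p', _, _, hx'⟩
          · rw [hc] at hx'; simp only [Prod.mk.injEq] at hx'
            rw [← hx'.1] at hx'; simp [hs] at hx'
          · rw [hc] at hx'; simp only [Prod.mk.injEq] at hx'
            rw [← hx'.1] at hx'; simp [hs] at hx'
    · simp only [Prod.mk.injEq] at hx
      rw [← hx.1] at hx; simp [hr] at hx

/-- Deterministic and order-preserving on the traversing parts. -/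
def Good (ρ : Q → Bool) (rk : Q → ℕ) (f : Set (Q × Q)) : Prop :=
  IsDet f ∧ ∀ b q r q₂ r₂, ρ q = b → ρ r = b → ρ q₂ = b → ρ r₂ = b →
    (q, r) ∈ f → (q₂, r₂) ∈ f → r ≠ r₂ → (rk q < rk q₂ ↔ rk r < rk r₂)

/-- On states of direction `b`, `y` has at most the domain, at least the kernel and at most the
image of `e`. -/
def Below (ρ : Q → Bool) (b : Bool) (y e : Set (Q × Q)) : Prop :=
  ∀ q r, ρ q = b → ρ r = b → (q, r) ∈ y →
    (∃ s, ρ s = b ∧ (q, s) ∈ e ∧ ∀ q', ρ q' = b → (q', s) ∈ e → (q', r) ∈ y) ∧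
    (∃ q', ρ q' = b ∧ (q', r) ∈ e)

theorem mono_surj_step {ρ : Q → Bool} {rk : Q → ℕ} (hinj : Function.Injective rk)
    {b : Bool} {e y : Set (Q × Q)} (he : Good ρ rk e) (hy : Good ρ rk y)
    (h1 : Below ρ b y e) (h2 : Below ρ b e y) (q : Q)
    (ih : ∀ q', rk q' < rk q → ∀ r, ρ q' = b → ρ r = b → ((q', r) ∈ e ↔ (q', r) ∈ y))
    (r : Q) (hq : ρ q = b) (hr : ρ r = b) (h : (q, r) ∈ e) : (q, r) ∈ y := by
  obtain ⟨⟨s, hs, hqs, ker⟩, q1, hq1, hq1r⟩ := h2 q r hq hr h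
  obtain ⟨⟨t, ht, hqt, ker'⟩, q2, hq2, hq2s⟩ := h1 q s hq hs hqs
  obtain rfl : r = t := he.1 _ _ _ h hqt
  by_cases hrs : r = s
  · rw [hrs]; exact hqs
  exfalso
  rcases lt_trichotomy (rk r) (rk s) with hlt | heq | hlt
  · have hlt' := (hy.2 b q1 r q s hq1 hr hq hs hq1r hqs hrs).2 hlt
    have := (ih q1 hlt' r hq1 hr).2 hq1r
    exact hrs (hy.1 _ _ _ hq1r (ker' q1 hq1 this))
  · exact hrs (hinj heq)
  · have hlt' := (he.2 b q2 s q r hq2 hs hq hr hq2s h (Ne.symm hrs)).2 hlt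
    have := (ih q2 hlt' s hq2 hs).1 hq2s
    exact hrs (he.1 _ _ _ (ker q2 hq2 this) hq2s)

theorem mono_surj {ρ : Q → Bool} {rk : Q → ℕ} (hinj : Function.Injective rk)
    {b : Bool} {e y : Set (Q × Q)} (he : Good ρ rk e) (hy : Good ρ rk y)
    (h1 : Below ρ b y e) (h2 : Below ρ b e y) :
    ∀ n q, rk q = n → ∀ r, ρ q = b → ρ r = b → ((q, r) ∈ e ↔ (q, r) ∈ y) := by
  intro n
  induction n using Nat.strong_induction_on with
  | _ n ih =>
    intro q hqn r hq hr
    have ih' : ∀ q', rk q' < rk q → ∀ r, ρ q' = b → ρ r = b → ((q', r) ∈ e ↔ (q', r) ∈ y) :=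
      fun q' h => ih (rk q') (hqn ▸ h) q' rfl
    constructor
    · exact mono_surj_step hinj he hy h1 h2 q ih' r hq hr
    · exact mono_surj_step hinj hy he h2 h1 q
        (fun q' h r a b => (ih' q' h r a b).symm) r hq hr

theorem below_of {ρ : Q → Bool} {b : Bool} {y e s t : Set (Q × Q)}
    (h1 : y = glue ρ e s) (h2 : y = glue ρ t e) : Below ρ b y e := by
  intro q r hq hr h
  cases b
  · refine ⟨?_, ?_⟩
    · rw [h2] at h ⊢; exact glue_B_ker hq hr h
    · rw [h1] at h; exact glue_B_im hq hr h
  · refine ⟨?_, ?_⟩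
    · rw [h1] at h ⊢; exact glue_F_ker hq hr h
    · rw [h2] at h; exact glue_F_im hq hr h

theorem H_trivial {ρ : Q → Bool} {rk : Q → ℕ} (hinj : Function.Injective rk)
    {e y s t s' t' : Set (Q × Q)} (he : Good ρ rk e) (hy : Good ρ rk y)
    (h1 : y = glue ρ e s) (h2 : y = glue ρ t e) (h3 : e = glue ρ y s') (h4 : e = glue ρ t' y) :
    y = e := by
  ext ⟨q, r⟩
  cases hq : ρ q <;> cases hr : ρ r
  · exact (mono_surj hinj he hy (below_of h1 h2) (below_of h3 h4) _ q rfl r hq hr).symm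
  · constructor
    · intro h; rw [h4]; exact glue_RR hq hr h
    · intro h; rw [h2]; exact glue_RR hq hr h
  · constructor
    · intro h; rw [h3]; exact glue_LL hq hr h
    · intro h; rw [h1]; exact glue_LL hq hr h
  · exact (mono_surj hinj he hy (below_of h1 h2) (below_of h3 h4) _ q rfl r hq hr).symm

theorem exists_rank [Fintype Q] (lt : Q → Q → Prop) (h : IsStrictTotalOrder Q lt) :
    ∃ rk : Q → ℕ, Function.Injective rk ∧ ∀ a b, lt a b ↔ rk a < rk b := by
  classical
  let _ : LinearOrder Q := linearOrderOfSTO lt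
  have hlt : ∀ a b : Q, lt a b ↔ a < b := fun a b => Iff.rfl
  let e := (Fintype.orderIsoFinOfCardEq Q rfl)
  refine ⟨fun q => (e.symm q : ℕ), ?_, ?_⟩
  · intro a b hab
    exact e.symm.injective (Fin.ext hab)
  · intro a b
    rw [hlt, ← e.symm.lt_iff_lt]; rfl

theorem inBehav_words {A B : Type} (T : TwoWayTransducer Q A B) {f : Set (Q × Q)}
    (h : InBehav T f) : ∃ w : List (Set (Q × Q)),
      (∀ g ∈ w, ∃ a : A, g = T.rel (Tape.sym a)) ∧ f = beh T.ρ w := by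
  induction h with
  | one => exact ⟨[], by simp, (beh_nil _).symm⟩
  | gen a => exact ⟨[T.rel (Tape.sym a)], fun g hg => ⟨a, by simpa using hg⟩, (beh_single _ _).symm⟩
  | mul _ _ ih1 ih2 =>
    obtain ⟨w1, hw1, rfl⟩ := ih1
    obtain ⟨w2, hw2, rfl⟩ := ih2
    refine ⟨w1 ++ w2, ?_, glue_beh _ _ _⟩
    intro g hg
    rcases List.mem_append.1 hg with hg | hg
    · exact hw1 g hg
    · exact hw2 g hg

theorem inBehav_pow {A B : Type} (T : TwoWayTransducer Q A B) {f : Set (Q × Q)}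
    (h : InBehav T f) (k : ℕ) : InBehav T (glpow T.ρ f k) := by
  induction k with
  | zero => exact InBehav.one
  | succ n ih => exact InBehav.mul ih h

theorem apBehav_of_planar {A B : Type} [Fintype Q] (T : TwoWayTransducer Q A B)
    (hpl : T.Planar) (hdet : T.Deterministic) : ApBehav T := by
  obtain ⟨lt, hlt, hpl⟩ := hpl
  obtain ⟨rk, hinj, hrk⟩ := exists_rank lt hlt
  have good : ∀ f, InBehav T f → Good T.ρ rk f := by
    intro f hf
    obtain ⟨w, hw, rfl⟩ := inBehav_words T hf
    have hd : ∀ g ∈ w, IsDet g := by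
      intro g hg
      obtain ⟨a, rfl⟩ := hw g hg
      exact hdet _
    have hp : ∀ g ∈ w, IsPlanar T.ρ lt g := by
      intro g hg
      obtain ⟨a, rfl⟩ := hw g hg
      exact hpl _
    refine ⟨beh_det hd, ?_⟩
    intro b q r q' r' h1 h2 h3 h4 h h' hne
    exact beh_mono hrk hinj hd hp h h' (h3.trans h1.symm) (h2.trans h1.symm) (h4.trans h1.symm) hne
  refine ⟨Nat.card (Set (Q × Q)), fun f hf => ?_⟩
  have hex : ∃ i j, i < j ∧ j ≤ Nat.card (Set (Q × Q)) ∧ glpow T.ρ f i = glpow T.ρ f j := by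
    classical
    have : Fintype (Set (Q × Q)) := Fintype.ofFinite _
    obtain ⟨a, b, hab, h⟩ := Fintype.exists_ne_map_eq_of_card_lt
      (fun i : Fin (Nat.card (Set (Q × Q)) + 1) => glpow T.ρ f i)
      (by rw [Fintype.card_fin, Nat.card_eq_fintype_card]; omega)
    rcases lt_or_gt_of_ne hab with hlt | hlt
    · exact ⟨a, b, hlt, by omega, h⟩
    · exact ⟨b, a, hlt, by omega, h.symm⟩
  obtain ⟨i, j, hij, hj, heq⟩ := hex
  have step : glpow T.ρ f (i + 1) = glpow T.ρ f i := by
    obtain ⟨d, rfl⟩ : ∃ d, j = i + 1 + d := ⟨j - (i + 1), by omega⟩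
    refine H_trivial hinj (good _ (inBehav_pow T hf i)) (good _ (inBehav_pow T hf (i + 1)))
      (s := f) (t := f) (s' := glpow T.ρ f d) (t' := glpow T.ρ f d) rfl ?_ ?_ ?_
    · rw [glue_assoc_words, glue_assoc_words, List.replicate_succ]
      conv_rhs => rw [← beh_single T.ρ f]
      rw [beh_single, ← List.singleton_append, ← glue_beh, beh_single]
    · rw [heq]
      simp only [glue_assoc_words]
      rw [glue_beh, ← List.replicate_add]
    · rw [heq]
      simp only [glue_assoc_words]
      rw [glue_beh, ← List.replicate_add, add_comm d]
  have hstab : ∀ n, glpow T.ρ f (i + n + 1) = glpow T.ρ f (i + n) := by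
    intro n
    induction n with
    | zero => exact step
    | succ n ih =>
      show glue T.ρ (glpow T.ρ f (i + n + 1)) f = glue T.ρ (glpow T.ρ f (i + n)) f
      rw [ih]
  have := hstab (Nat.card (Set (Q × Q)) - i)
  rw [show i + (Nat.card (Set (Q × Q)) - i) = Nat.card (Set (Q × Q)) by omega] at this
  exact this

/-- Transport of a transducer along a bijection of states. -/
def mapT {Q' A B : Type} (e : Q ≃ Q') (T : TwoWayTransducer Q A B) : TwoWayTransducer Q' A B where
  ρ := fun q => T.ρ (e.symm q)
  init := e T.init
  init_fwd := by simpa using T.init_fwd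
  final := {q | e.symm q ∈ T.final}
  δ := fun a => {t | (e.symm t.1, t.2.1, e.symm t.2.2) ∈ T.δ a}

theorem mapT_step {Q' A B : Type} (e : Q ≃ Q') (T : TwoWayTransducer Q A B)
    {c c' : Config Q A} {w : List B} (h : T.Step c w c') :
    (mapT e T).Step (c.1, e c.2.1, c.2.2) w (c'.1, e c'.2.1, c'.2.2) := by
  obtain ⟨a, u, v, q, r, hδ, h⟩ := h
  refine ⟨a, u, v, e q, e r, by simpa [mapT] using hδ, ?_⟩
  rcases h with ⟨h1, h2, rfl, rfl⟩ | ⟨h1, h2, rfl, rfl⟩ | ⟨h1, h2, rfl, rfl⟩ | ⟨h1, h2, rfl, rfl⟩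
  · left; simp [mapT, h1, h2]
  · right; left; simp [mapT, h1, h2]
  · right; right; left; simp [mapT, h1, h2]
  · right; right; right; simp [mapT, h1, h2]

theorem mapT_run {Q' A B : Type} (e : Q ≃ Q') (T : TwoWayTransducer Q A B)
    {c c' : Config Q A} {w : List B} (h : T.Run c w c') :
    (mapT e T).Run (c.1, e c.2.1, c.2.2) w (c'.1, e c'.2.1, c'.2.2) := by
  induction h with
  | refl => exact TwoWayTransducer.Run.refl _
  | step _ hs ih => exact TwoWayTransducer.Run.step ih (mapT_step e T hs)

theorem mapT_realizes {Q' A B : Type} (e : Q ≃ Q') (T : TwoWayTransducer Q A B)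
    {u : List A} {v : List B} (h : T.Realizes u v) : (mapT e T).Realizes u v := by
  obtain ⟨qf, hqf, h⟩ := h
  exact ⟨e qf, by simpa [mapT] using hqf, mapT_run e T h⟩

theorem mapT_symm {Q' A B : Type} (e : Q ≃ Q') (T : TwoWayTransducer Q A B) :
    mapT e.symm (mapT e T) = T := by
  cases T
  simp [mapT]

theorem mapT_det {Q' A B : Type} (e : Q ≃ Q') (T : TwoWayTransducer Q A B)
    (h : T.Deterministic) : (mapT e T).Deterministic := by
  intro a q r r' h1 h2
  exact e.symm.injective (h a (e.symm q) (e.symm r) (e.symm r') h1 h2)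

theorem mapT_planar {Q' A B : Type} (e : Q ≃ Q') (T : TwoWayTransducer Q A B)
    (h : T.Planar) : (mapT e T).Planar := by
  obtain ⟨lt, hlt, hpl⟩ := h
  refine ⟨fun a b => lt (e.symm a) (e.symm b), ?_, ?_⟩
  · exact (RelEmbedding.preimage e.symm.toEmbedding lt).isStrictTotalOrder
  · rintro a ⟨u, r, v, s, h1, h2, h3, h4, h5⟩
    have hedge : ∀ x y : Q' × Bool, ProfileEdge (mapT e T).ρ ((mapT e T).rel (Tape.sym a)) x y →
        ProfileEdge T.ρ (T.rel (Tape.sym a)) (e.symm x.1, x.2) (e.symm y.1, y.2) := by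
      rintro x y ⟨p, hp, rfl, rfl⟩
      exact ⟨(e.symm p.1, e.symm p.2), hp, rfl, rfl⟩
    exact hpl a ⟨(e.symm u.1, u.2), (e.symm r.1, r.2), (e.symm v.1, v.2), (e.symm s.1, s.2),
      h1, h2, h3, h4.imp (hedge _ _) (hedge _ _), h5.imp (hedge _ _) (hedge _ _)⟩

end Proof

/-- the behaviour monoid of a planar deterministic two-way
transducer is aperiodic; consequently every planar deterministic two-way
transducer computes a first-order transduction. -/
theorem planar_det_behaviour_aperiodic {Q A B : Type} [Fintype Q]
    [Fintype A] [Fintype B] (T : TwoWayTransducer Q A B)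
    (hpl : T.Planar) (hdet : T.Deterministic) :
    ApBehav T ∧ ∀ f : List A → Option (List B), T.Computes f → IsFOTransduction f := by
  refine ⟨apBehav_of_planar T hpl hdet, fun f hf => ?_⟩
  let e := Fintype.equivFin Q
  have hdet' := mapT_det e T hdet
  refine ⟨Fintype.card Q, mapT e T, hdet', apBehav_of_planar _ (mapT_planar e T hpl) hdet', ?_⟩
  intro u v
  rw [hf u v]
  constructor
  · exact mapT_realizes e T
  · intro h
    have := mapT_realizes e.symm _ h
    rwa [mapT_symm] at this
end Planar2DFT
end
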